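/- arXiv:1501.06213 — 5 statements merged into one kernel-verified Lean document; each statement's English description precedes it below -/
import Mathlib

section
/- For every α ≥ 0, every n ∈ ℕ with n ≥ 1, and every polynomial P ∈ P_n, ‖P'‖_{L²(ℝ,w)} ≤ √(2n) · ‖P‖_{L²(ℝ,w)}, where w(x) = |x|^α e^{−x²} on ℝ. -/
open MeasureTheory Polynomial

/-- The weighted L² norm of a polynomial `P` over a set `A ⊆ ℝ` with weight `w`:
`‖P‖_{L²(A,w)} = (∫_A |P(x)|² w(x) dx)^{1/2}`. -/
noncomputable def L2w (A : Set ℝ) (w : ℝ → ℝ) (P : Polynomial ℝ) : ℝ :=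
  Real.sqrt (∫ x in A, (P.eval x) ^ 2 * w x)

/-- The weighted Sobolev norm
`‖P‖_{W^{k,2}(A; w, λ₁w, …, λ_k w)} = (‖P‖²_{L²(A,w)} + ∑_{j=1}^k λ_j ‖P^{(j)}‖²_{L²(A,w)})^{1/2}`. -/
noncomputable def sobNorm (A : Set ℝ) (w : ℝ → ℝ) (k : ℕ) (lam : ℕ → ℝ)
    (P : Polynomial ℝ) : ℝ :=
  Real.sqrt ((L2w A w P) ^ 2 +
    ∑ j ∈ Finset.Icc 1 k, lam j * (L2w A w (derivative^[j] P)) ^ 2)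

/-- The linear map sending `P` to `(P(X) - P(-X)) / (2X)`, the odd part of `P` divided by `X`. -/
noncomputable def oddPartDivX : ℝ[X] →ₗ[ℝ] ℝ[X] :=
  Polynomial.lsum fun k => if Odd k then monomial (k - 1) else 0

/-- The second-order differential-difference operator
`P ↦ -D² P + 2 x D P - α (D P - P_odd / x) / x`, where `D` is the derivative and `P_odd` the odd
part of `P`, given on monomials. -/
noncomputable def dunklHermiteOp (α : ℝ) : ℝ[X] →ₗ[ℝ] ℝ[X] :=
  Polynomial.lsum fun k => (2 * (k : ℝ)) • monomial k -
    ((k : ℝ) * (k - 1) + α * (k - if Odd k then 1 else 0)) • monomial (k - 2)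

lemma oddPartDivX_monomial (k : ℕ) (a : ℝ) :
    oddPartDivX (monomial k a) = if Odd k then monomial (k - 1) a else 0 := by
  rw [oddPartDivX, Polynomial.lsum_apply, Polynomial.sum_monomial_index _ _ (by simp)]
  split_ifs <;> simp

lemma dunklHermiteOp_monomial (α : ℝ) (k : ℕ) (a : ℝ) :
    dunklHermiteOp α (monomial k a) = (2 * (k : ℝ)) • monomial k a -
      ((k : ℝ) * (k - 1) + α * (k - if Odd k then 1 else 0)) • monomial (k - 2) a := by
  rw [dunklHermiteOp, Polynomial.lsum_apply, Polynomial.sum_monomial_index _ _ (by simp)]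
  simp

lemma degreeLT_induction {n : ℕ} {p : ℝ[X] → Prop} (h0 : p 0)
    (hadd : ∀ P Q, p P → p Q → p (P + Q)) (hmon : ∀ k < n, ∀ a, p (monomial k a))
    {P : ℝ[X]} (hP : P ∈ degreeLT ℝ n) : p P := by
  rw [P.as_sum_support]
  refine Finset.sum_induction _ p hadd h0 fun k hk => hmon k ?_ _
  exact_mod_cast (le_degree_of_mem_supp k hk).trans_lt (mem_degreeLT.1 hP)

lemma monomial_mem_degreeLT {k n : ℕ} (h : k < n) (a : ℝ) : monomial k a ∈ degreeLT ℝ n :=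
  monomial_coe_mem_degreeLT ⟨k, h⟩ a

lemma dunklHermiteOp_mem_degreeLT (α : ℝ) {n : ℕ} {P : ℝ[X]} (hP : P ∈ degreeLT ℝ n) :
    dunklHermiteOp α P ∈ degreeLT ℝ n := by
  refine degreeLT_induction (p := fun P => dunklHermiteOp α P ∈ degreeLT ℝ n) (by simp)
    (fun P Q h₁ h₂ => by simpa using add_mem h₁ h₂) (fun k hk a => ?_) hP
  rw [dunklHermiteOp_monomial]
  exact sub_mem (Submodule.smul_mem _ _ (monomial_mem_degreeLT hk a))
    (Submodule.smul_mem _ _ (monomial_mem_degreeLT (by omega) a))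

/-- On polynomials of degree at most `n`, `dunklHermiteOp α` multiplies the coefficient of `X ^ n`
by `2 * n`. -/
lemma dunklHermiteOp_sub_smul_mem_degreeLT (α : ℝ) {n : ℕ} {P : ℝ[X]}
    (hP : P ∈ degreeLT ℝ (n + 1)) :
    dunklHermiteOp α P - (2 * (n : ℝ)) • P ∈ degreeLT ℝ n := by
  refine degreeLT_induction
    (p := fun P => dunklHermiteOp α P - (2 * (n : ℝ)) • P ∈ degreeLT ℝ n) (by simp)
    (fun P Q h₁ h₂ => ?_) (fun k hk a => ?_) hP
  · convert add_mem h₁ h₂ using 1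
    rw [map_add, smul_add]
    abel
  rw [dunklHermiteOp_monomial]
  rcases Nat.lt_succ_iff_lt_or_eq.1 hk with hk | rfl
  · exact sub_mem (sub_mem (Submodule.smul_mem _ _ (monomial_mem_degreeLT hk a))
      (Submodule.smul_mem _ _ (monomial_mem_degreeLT (by omega) a)))
      (Submodule.smul_mem _ _ (monomial_mem_degreeLT hk a))
  · rw [sub_sub_cancel_left]
    rcases k with _ | k
    · simp
    · exact neg_mem (Submodule.smul_mem _ _ (monomial_mem_degreeLT (by omega) a))

/-- Orthogonal projection onto polynomials of degree less than `n`, with respect to a linear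
functional that is positive on nonzero squares. -/
lemma exists_mem_degreeLT_orthogonal (M : ℝ[X] →ₗ[ℝ] ℝ) (hpos : ∀ P, P ≠ 0 → 0 < M (P * P))
    (n : ℕ) (P : ℝ[X]) :
    ∃ R ∈ degreeLT ℝ n, ∀ Q ∈ degreeLT ℝ n, M ((P - R) * Q) = 0 := by
  have : Module.Finite ℝ (degreeLT ℝ n) := Module.Finite.equiv (degreeLTEquiv ℝ n).symm
  let B : ℝ[X] →ₗ[ℝ] (Module.Dual ℝ (degreeLT ℝ n)) :=
    ((LinearMap.mul ℝ ℝ[X]).compr₂ M).compl₂ (degreeLT ℝ n).subtype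
  have hB (P : ℝ[X]) (Q : degreeLT ℝ n) : B P Q = M (P * Q) := rfl
  have hinj : Function.Injective (B ∘ₗ (degreeLT ℝ n).subtype) := by
    rw [injective_iff_map_eq_zero]
    intro R hR
    by_contra h
    have h₁ := hpos R (by simpa using h)
    rw [← hB R R] at h₁
    have h₂ := LinearMap.congr_fun hR R
    simp only [LinearMap.comp_apply, Submodule.subtype_apply, LinearMap.zero_apply] at h₂
    exact h₁.ne' h₂
  obtain ⟨R, hR⟩ := (LinearMap.injective_iff_surjective_of_finrank_eq_finrank
    Subspace.dual_finrank_eq.symm).1 hinj (B P)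
  refine ⟨R, R.2, fun Q hQ => ?_⟩
  have := LinearMap.congr_fun hR ⟨Q, hQ⟩
  simp only [LinearMap.comp_apply, Submodule.subtype_apply, hB] at this
  rw [sub_mul, map_sub, this, sub_self]

/-- Integration by parts for `dunklHermiteOp α`, in terms of moments. -/
lemma moment_dunklHermiteOp {α : ℝ} {M : ℝ[X] →ₗ[ℝ] ℝ}
    (hodd : ∀ k, Odd k → ∀ a, M (monomial k a) = 0)
    (heven : ∀ k, Even k → ∀ a, 2 * M (monomial (k + 2) a) = (k + 1 + α) * M (monomial k a))
    (P Q : ℝ[X]) :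
    M (derivative P * derivative Q) + α * M (oddPartDivX P * oddPartDivX Q) =
      M (P * dunklHermiteOp α Q) := by
  induction P using Polynomial.induction_on' with
  | add P₁ P₂ h₁ h₂ =>
    simp only [map_add, add_mul]
    rw [← h₁, ← h₂]
    ring
  | monomial j a =>
  induction Q using Polynomial.induction_on' with
  | add Q₁ Q₂ h₁ h₂ =>
    simp only [map_add, mul_add]
    rw [← h₁, ← h₂]
    ring
  | monomial k b =>
  obtain ⟨m, hm⟩ : ∃ m : ℕ → ℝ, ∀ i c, M (monomial i c) = c * m i :=
    ⟨fun i => M (monomial i 1), fun i c => by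
      rw [← smul_eq_mul, ← map_smul, smul_monomial, smul_eq_mul, mul_one]⟩
  have hodd' (i : ℕ) (hi : Odd i) : m i = 0 := by simpa [hm] using hodd i hi 1
  have heven' (i : ℕ) (hi : Even i) : 2 * m (i + 2) = (i + 1 + α) * m i := by
    simpa [hm] using heven i hi 1
  have hlast : M (oddPartDivX (monomial j a) * oddPartDivX (monomial k b)) =
      if Odd j ∧ Odd k then a * b * m (j - 1 + (k - 1)) else 0 := by
    rw [oddPartDivX_monomial, oddPartDivX_monomial]
    by_cases hj : Odd j <;> by_cases hk : Odd k <;> simp [hj, hk, monomial_mul_monomial, hm]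
  rw [dunklHermiteOp_monomial, hlast, derivative_monomial, derivative_monomial, mul_sub,
    mul_smul_comm, mul_smul_comm, map_sub, map_smul, map_smul]
  simp only [monomial_mul_monomial, smul_eq_mul, hm]
  rcases Nat.even_or_odd (j + k) with hjk | hjk
  · have hpar : Odd j ↔ Odd k := by grind
    simp only [hpar, and_self]
    rcases k with _ | _ | k
    · simp
    · rcases j with _ | j
      · simp at hjk
      have h := heven' j (by grind)
      simp only [zero_add, odd_one, if_true, Nat.cast_one, Nat.cast_add, add_tsub_cancel_right,
        tsub_self, add_zero, add_assoc, Nat.reduceAdd]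
      linear_combination (-a * b) * h
    · rcases j with _ | j
      · have h := heven' k (by grind)
        have hk : ¬ Odd (k + 2) := by grind
        simp only [hk, if_false, zero_add, Nat.cast_zero, mul_zero, zero_mul]
        push_cast
        linear_combination (-a * b * (k + 2)) * h
      · have h := heven' (j + 1 + k) (by grind)
        have e₁ : j + 1 - 1 + (k + 1 + 1 - 1) = j + 1 + k := by omega
        have e₂ : j + 1 + (k + 1 + 1 - 2) = j + 1 + k := by omega
        have e₃ : j + 1 + (k + 1 + 1) = j + 1 + k + 2 := by omega
        rw [e₁, e₂, e₃]
        push_cast at h ⊢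
        split_ifs <;> linear_combination (-a * b * (k + 2)) * h
  · have hpar : ¬ (Odd j ∧ Odd k) := by grind
    rw [if_neg hpar, hodd' _ hjk]
    rcases k with _ | _ | k
    · simp
    · simp
      grind
    · rcases j with _ | j
      · simp
        grind
      · rw [hodd' (j + 1 - 1 + (k + 1 + 1 - 1)) (by grind),
          hodd' (j + 1 + (k + 1 + 1 - 2)) (by grind)]
        simp

lemma dunklHermite_energy_le {α : ℝ} {M : ℝ[X] →ₗ[ℝ] ℝ} (hpos : ∀ P, P ≠ 0 → 0 < M (P * P))
    (hodd : ∀ k, Odd k → ∀ a, M (monomial k a) = 0)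
    (heven : ∀ k, Even k → ∀ a, 2 * M (monomial (k + 2) a) = (k + 1 + α) * M (monomial k a))
    (n : ℕ) {P : ℝ[X]} (hP : P ∈ degreeLT ℝ (n + 1)) :
    M (P * dunklHermiteOp α P) ≤ 2 * n * M (P * P) := by
  have hnonneg (P : ℝ[X]) : 0 ≤ M (P * P) := by
    rcases eq_or_ne P 0 with rfl | h
    · simp
    · exact (hpos P h).le
  have hsymm (P Q : ℝ[X]) : M (P * dunklHermiteOp α Q) = M (Q * dunklHermiteOp α P) := by
    rw [← moment_dunklHermiteOp hodd heven, ← moment_dunklHermiteOp hodd heven,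
      mul_comm (derivative P), mul_comm (oddPartDivX P)]
  induction n generalizing P with
  | zero =>
    have h := dunklHermiteOp_sub_smul_mem_degreeLT α hP
    have h0 : dunklHermiteOp α P = 0 := by
      simpa [mem_degreeLT, Polynomial.degree_lt_iff_coeff_zero, Polynomial.ext_iff] using h
    simp [h0]
  | succ n ih =>
    obtain ⟨R, hR, horth⟩ := exists_mem_degreeLT_orthogonal M hpos (n + 1) P
    set S := P - R with hS
    have hPS : P = S + R := by simp [hS]
    have hSmem : S ∈ degreeLT ℝ (n + 1 + 1) :=
      sub_mem hP (degreeLT_mono (Nat.le_succ _) hR)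
    have h₁ := ih hR
    have h₂ : M (S * R) = 0 := horth R hR
    have h₃ : M (S * dunklHermiteOp α R) = 0 := horth _ (dunklHermiteOp_mem_degreeLT α hR)
    have h₄ := horth _ (dunklHermiteOp_sub_smul_mem_degreeLT α hSmem)
    rw [mul_sub, map_sub, mul_smul_comm, map_smul, smul_eq_mul] at h₄
    have h₅ := hsymm R S
    rw [hPS]
    simp only [map_add, mul_add, add_mul]
    rw [mul_comm R S, h₂, h₅, h₃]
    have := hnonneg R
    push_cast at h₄ ⊢
    linarith

lemma integrable_pow_mul_generalizedHermite {α : ℝ} (hα : 0 ≤ α) (k : ℕ) :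
    Integrable fun x : ℝ => x ^ k * (|x| ^ α * Real.exp (-x ^ 2)) := by
  have hk : (0 : ℝ) ≤ k := k.cast_nonneg
  have h := integrable_rpow_mul_exp_neg_mul_sq one_pos (s := k + α) (by linarith)
  refine (h.norm.add h.comp_neg.norm).mono'
    (by fun_prop) (Filter.Eventually.of_forall fun x => ?_)
  have hx : |x| ^ k * |x| ^ α = |x| ^ (k + α) := by
    rw [Real.rpow_add_of_nonneg (abs_nonneg x) hk hα, Real.rpow_natCast]
  have hle : |x| ^ (k + α) ≤ |x ^ (k + α)| + |(-x) ^ (k + α)| := by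
    rcases abs_choice x with h | h <;> rw [h] <;> grind
  simp only [Pi.add_apply, norm_mul, norm_pow, Real.norm_eq_abs, Real.abs_exp, neg_mul, one_mul,
    neg_sq, ← add_mul, Real.abs_rpow_of_nonneg (abs_nonneg x), abs_abs, ← mul_assoc, hx]
  gcongr

lemma integrable_eval_mul_generalizedHermite {α : ℝ} (hα : 0 ≤ α) (P : ℝ[X]) :
    Integrable fun x : ℝ => P.eval x * (|x| ^ α * Real.exp (-x ^ 2)) := by
  induction P using Polynomial.induction_on' with
  | add P Q hP hQ => simp only [eval_add, add_mul]; exact hP.add hQ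
  | monomial k a =>
    simpa only [eval_monomial, mul_assoc] using
      (integrable_pow_mul_generalizedHermite hα k).const_mul a

/-- Integration of polynomials against the generalized Hermite weight. -/
noncomputable def generalizedHermiteFunctional {α : ℝ} (hα : 0 ≤ α) : ℝ[X] →ₗ[ℝ] ℝ where
  toFun P := ∫ x, P.eval x * (|x| ^ α * Real.exp (-x ^ 2))
  map_add' P Q := by
    simp only [eval_add, add_mul]
    exact integral_add (integrable_eval_mul_generalizedHermite hα P)
      (integrable_eval_mul_generalizedHermite hα Q)
  map_smul' c P := by
    simp only [eval_smul, smul_eq_mul, mul_assoc, RingHom.id_apply]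
    exact integral_const_mul _ _

lemma generalizedHermiteFunctional_apply {α : ℝ} (hα : 0 ≤ α) (P : ℝ[X]) :
    generalizedHermiteFunctional hα P = ∫ x, P.eval x * (|x| ^ α * Real.exp (-x ^ 2)) := rfl

lemma generalizedHermiteFunctional_mul_self_pos {α : ℝ} (hα : 0 ≤ α) {P : ℝ[X]} (hP : P ≠ 0) :
    0 < generalizedHermiteFunctional hα (P * P) := by
  rw [generalizedHermiteFunctional_apply, integral_pos_iff_support_of_nonneg _
    (integrable_eval_mul_generalizedHermite hα _)]
  · have hfin : ((X * P).rootSet ℝ).Finite := (X * P).rootSet_finite ℝ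
    have hsub : ((X * P).rootSet ℝ)ᶜ ⊆
        Function.support fun x => (P * P).eval x * (|x| ^ α * Real.exp (-x ^ 2)) := by
      intro x hx
      have hx' : x ≠ 0 ∧ P.eval x ≠ 0 := by simpa [mem_rootSet, hP, X_ne_zero] using hx
      have : 0 < |x| ^ α := Real.rpow_pos_of_pos (abs_pos.2 hx'.1) _
      simp [hx'.2, this.ne']
    refine lt_of_lt_of_le ?_ (measure_mono hsub)
    rw [measure_compl hfin.measurableSet (by simp [hfin.measure_zero]), hfin.measure_zero]
    simp
  · intro x
    simp only [eval_mul, Pi.zero_apply]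
    exact mul_nonneg (mul_self_nonneg _) (by positivity)

lemma generalizedHermiteFunctional_monomial_odd {α : ℝ} (hα : 0 ≤ α) {k : ℕ} (hk : Odd k)
    (a : ℝ) : generalizedHermiteFunctional hα (monomial k a) = 0 := by
  have h := integral_neg_eq_self
    (fun x : ℝ => (monomial k a).eval x * (|x| ^ α * Real.exp (-x ^ 2))) volume
  simp only [eval_monomial, hk.neg_pow, abs_neg, neg_sq, mul_neg, neg_mul, integral_neg] at h
  rw [generalizedHermiteFunctional_apply]
  simp only [eval_monomial]
  linarith

lemma generalizedHermiteFunctional_monomial_even {α : ℝ} (hα : 0 ≤ α) {k : ℕ} (hk : Even k)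
    (a : ℝ) :
    generalizedHermiteFunctional hα (monomial k a) = a * Real.Gamma ((k + α + 1) / 2) := by
  have hk0 : (0 : ℝ) ≤ k := k.cast_nonneg
  have h := integral_comp_abs (f := fun x : ℝ => a * (x ^ k * (x ^ α * Real.exp (-x ^ 2))))
  simp only [hk.pow_abs, sq_abs] at h
  rw [generalizedHermiteFunctional_apply]
  simp only [eval_monomial, mul_assoc]
  rw [h, integral_const_mul]
  have h₁ : ∫ x in Set.Ioi (0 : ℝ), x ^ k * (x ^ α * Real.exp (-x ^ 2)) =
      ∫ x in Set.Ioi (0 : ℝ), x ^ (k + α) * Real.exp (-x ^ (2 : ℝ)) := by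
    refine setIntegral_congr_fun measurableSet_Ioi fun x hx => ?_
    simp only [Real.rpow_add hx, Real.rpow_natCast, Real.rpow_two, mul_assoc]
  rw [h₁, integral_rpow_mul_exp_neg_rpow two_pos (by linarith)]
  ring

lemma generalizedHermiteFunctional_monomial_add_two {α : ℝ} (hα : 0 ≤ α) {k : ℕ} (hk : Even k)
    (a : ℝ) : 2 * generalizedHermiteFunctional hα (monomial (k + 2) a) =
      (k + 1 + α) * generalizedHermiteFunctional hα (monomial k a) := by
  have hk0 : (0 : ℝ) ≤ k := k.cast_nonneg
  rw [generalizedHermiteFunctional_monomial_even hα hk,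
    generalizedHermiteFunctional_monomial_even hα (hk.add even_two)]
  have : ((k + 2 : ℕ) + α + 1) / 2 = (k + α + 1) / 2 + 1 := by push_cast; ring
  rw [this, Real.Gamma_add_one (by positivity)]
  ring

lemma L2w_generalizedHermite {α : ℝ} (hα : 0 ≤ α) (P : ℝ[X]) :
    L2w Set.univ (fun x => |x| ^ α * Real.exp (-x ^ 2)) P =
      Real.sqrt (generalizedHermiteFunctional hα (P * P)) := by
  simp only [L2w, generalizedHermiteFunctional_apply, setIntegral_univ, eval_mul, sq]

/-- Markov inequality for the generalized Hermite weight `w(x) = |x|^α e^{-x²}` on `ℝ`, `α ≥ 0`. -/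
theorem generalized_hermite_markov (α : ℝ) (hα : 0 ≤ α) (n : ℕ) (hn : 1 ≤ n)
    (P : Polynomial ℝ) (hP : P.natDegree ≤ n) :
    L2w Set.univ (fun x => |x| ^ α * Real.exp (-x ^ 2)) (derivative P) ≤
      Real.sqrt (2 * n) * L2w Set.univ (fun x => |x| ^ α * Real.exp (-x ^ 2)) P := by
  have hpos (Q : ℝ[X]) := generalizedHermiteFunctional_mul_self_pos hα (P := Q)
  have hodd (k : ℕ) (hk : Odd k) := generalizedHermiteFunctional_monomial_odd hα hk
  have heven (k : ℕ) (hk : Even k) := generalizedHermiteFunctional_monomial_add_two hα hk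
  have hmem : P ∈ degreeLT ℝ (n + 1) :=
    mem_degreeLT.2 ((natDegree_le_iff_degree_le.1 hP).trans_lt (by exact_mod_cast n.lt_succ_self))
  have hle := dunklHermite_energy_le hpos hodd heven n hmem
  rw [← moment_dunklHermiteOp hodd heven] at hle
  have hnonneg : 0 ≤ generalizedHermiteFunctional hα (oddPartDivX P * oddPartDivX P) := by
    rcases eq_or_ne (oddPartDivX P) 0 with h | h
    · simp [h]
    · exact (hpos _ h).le
  rw [L2w_generalizedHermite hα, L2w_generalizedHermite hα, ← Real.sqrt_mul (by positivity)]
  exact Real.sqrt_le_sqrt (by linarith [mul_nonneg hα hnonneg])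
end

section
/- There exists a constant C_{α,β} > 0, depending only on α and β, such that for every n ∈ ℕ and every polynomial P ∈ P_n, ‖P'‖_{L²([−1,1],w)} ≤ C_{α,β} · n² · ‖P‖_{L²([−1,1],w)}, where w(x) = (1−x)^α (1+x)^β on [−1,1] and α, β > −1. -/
open MeasureTheory Polynomial

lemma intervalIntegrable_jacobiWeight {α β : ℝ} (hα : -1 < α) (hβ : -1 < β) :
    IntervalIntegrable (fun x : ℝ => (1 - x) ^ α * (1 + x) ^ β) volume (-1) 1 := by
  have hleft : IntervalIntegrable (fun x : ℝ => (1 - x) ^ α * (1 + x) ^ β) volume (-1) 0 := by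
    have h : IntervalIntegrable (fun x : ℝ => (1 + x) ^ β) volume (-1) 0 := by
      simpa using (intervalIntegral.intervalIntegrable_rpow' (a := 0) (b := 1) hβ).comp_add_left 1
    refine h.continuousOn_mul fun x hx => ContinuousAt.continuousWithinAt ?_
    rw [Set.uIcc_of_le (by norm_num)] at hx
    exact ContinuousAt.rpow_const (by fun_prop) (Or.inl (by linarith [hx.2]))
  have hright : IntervalIntegrable (fun x : ℝ => (1 - x) ^ α * (1 + x) ^ β) volume 0 1 := by
    have h : IntervalIntegrable (fun x : ℝ => (1 - x) ^ α) volume 0 1 := by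
      simpa using
        ((intervalIntegral.intervalIntegrable_rpow' (a := 0) (b := 1) hα).comp_sub_left 1).symm
    refine h.mul_continuousOn fun x hx => ContinuousAt.continuousWithinAt ?_
    rw [Set.uIcc_of_le (by norm_num)] at hx
    exact ContinuousAt.rpow_const (by fun_prop) (Or.inl (by linarith [hx.1]))
  exact hleft.trans hright

lemma intervalIntegrable_eval_mul_jacobiWeight {α β : ℝ} (hα : -1 < α) (hβ : -1 < β)
    (f : ℝ[X]) :
    IntervalIntegrable (fun x : ℝ => f.eval x * ((1 - x) ^ α * (1 + x) ^ β)) volume (-1) 1 :=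
  (intervalIntegrable_jacobiWeight hα hβ).continuousOn_mul f.continuous.continuousOn

/-- Integration of polynomials over `[-1, 1]` against the Jacobi weight. -/
noncomputable def jacobiIntegral {α β : ℝ} (hα : -1 < α) (hβ : -1 < β) : ℝ[X] →ₗ[ℝ] ℝ where
  toFun f := ∫ x in (-1 : ℝ)..1, f.eval x * ((1 - x) ^ α * (1 + x) ^ β)
  map_add' f g := by
    rw [← intervalIntegral.integral_add (intervalIntegrable_eval_mul_jacobiWeight hα hβ f)
      (intervalIntegrable_eval_mul_jacobiWeight hα hβ g)]
    simp only [eval_add, add_mul]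
  map_smul' c f := by
    simp only [eval_smul, smul_eq_mul, mul_assoc, intervalIntegral.integral_const_mul,
      RingHom.id_apply]

lemma jacobiIntegral_apply {α β : ℝ} (hα : -1 < α) (hβ : -1 < β) (f : ℝ[X]) :
    jacobiIntegral hα hβ f = ∫ x in (-1 : ℝ)..1, f.eval x * ((1 - x) ^ α * (1 + x) ^ β) := rfl

lemma L2w_jacobi_eq_sqrt {α β : ℝ} (hα : -1 < α) (hβ : -1 < β) (P : ℝ[X]) :
    L2w (Set.Icc (-1) 1) (fun x => (1 - x) ^ α * (1 + x) ^ β) P =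
      Real.sqrt (jacobiIntegral hα hβ (P ^ 2)) := by
  rw [L2w, jacobiIntegral_apply, integral_Icc_eq_integral_Ioc,
    intervalIntegral.integral_of_le (by norm_num)]
  simp only [eval_pow]

lemma jacobiIntegral_mono {α β : ℝ} (hα : -1 < α) (hβ : -1 < β) {f g : ℝ[X]}
    (h : ∀ x ∈ Set.Icc (-1 : ℝ) 1, f.eval x ≤ g.eval x) :
    jacobiIntegral hα hβ f ≤ jacobiIntegral hα hβ g := by
  refine intervalIntegral.integral_mono_on (by norm_num)
    (intervalIntegrable_eval_mul_jacobiWeight hα hβ f)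
    (intervalIntegrable_eval_mul_jacobiWeight hα hβ g) fun x hx => ?_
  have h₁ : 0 ≤ 1 - x := by linarith [hx.2]
  have h₂ : 0 ≤ 1 + x := by linarith [hx.1]
  exact mul_le_mul_of_nonneg_right (h x hx) (by positivity)

lemma jacobiIntegral_C_mul {α β : ℝ} (hα : -1 < α) (hβ : -1 < β) (c : ℝ) (f : ℝ[X]) :
    jacobiIntegral hα hβ (C c * f) = c * jacobiIntegral hα hβ f := by
  rw [← smul_eq_C_mul, map_smul, smul_eq_mul]

lemma jacobiIntegral_sq_nonneg {α β : ℝ} (hα : -1 < α) (hβ : -1 < β) (f : ℝ[X]) :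
    0 ≤ jacobiIntegral hα hβ (f ^ 2) := by
  rw [← map_zero (jacobiIntegral hα hβ)]
  exact jacobiIntegral_mono hα hβ fun x _ => by simpa using sq_nonneg (f.eval x)

/-- The linear polynomial `m` for which `((1 - x²) w)' = -m w`, where `w` is the Jacobi weight. -/
noncomputable def jacobiDrift (α β : ℝ) : ℝ[X] := C (α - β) + C (α + β + 2) * X

lemma jacobiIntegral_mul_derivative {α β : ℝ} (hα : -1 < α) (hβ : -1 < β) (f : ℝ[X]) :
    jacobiIntegral hα hβ ((1 - X ^ 2) * derivative f) =
      jacobiIntegral hα hβ (jacobiDrift α β * f) := by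
  rw [← sub_eq_zero, ← map_sub, jacobiIntegral_apply]
  have hcont : ContinuousOn
      (fun x : ℝ => f.eval x * ((1 - x) ^ (α + 1) * (1 + x) ^ (β + 1))) (Set.Icc (-1) 1) := by
    refine (f.continuous.mul (Continuous.mul ?_ ?_)).continuousOn
    · exact Continuous.rpow_const (by fun_prop) fun _ => Or.inr (by linarith)
    · exact Continuous.rpow_const (by fun_prop) fun _ => Or.inr (by linarith)
  rw [intervalIntegral.integral_eq_sub_of_hasDerivAt_of_le (by norm_num) hcont _
    (intervalIntegrable_eval_mul_jacobiWeight hα hβ _)]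
  · simp [Real.zero_rpow (show α + 1 ≠ 0 by linarith),
      Real.zero_rpow (show β + 1 ≠ 0 by linarith)]
  · intro x hx
    have h₁ : 0 < 1 - x := by linarith [hx.2]
    have h₂ : 0 < 1 + x := by linarith [hx.1]
    have d₁ := ((hasDerivAt_id x).const_sub 1).rpow_const (p := α + 1) (Or.inl h₁.ne')
    have d₂ := ((hasDerivAt_id x).const_add 1).rpow_const (p := β + 1) (Or.inl h₂.ne')
    refine ((f.hasDerivAt x).mul (d₁.mul d₂)).congr_deriv ?_
    simp only [id, add_sub_cancel_right, Real.rpow_add_one h₁.ne', Real.rpow_add_one h₂.ne',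
      jacobiDrift, eval_sub, eval_add, eval_mul, eval_pow, eval_one, eval_X, eval_C, Pi.mul_apply]
    ring

/-- The Jacobi differential operator `P ↦ m P' - (1 - x²) P''`. -/
noncomputable def jacobiOp (α β : ℝ) : ℝ[X] →ₗ[ℝ] ℝ[X] where
  toFun P := jacobiDrift α β * derivative P - (1 - X ^ 2) * derivative (derivative P)
  map_add' P Q := by simp only [map_add]; ring
  map_smul' c P := by simp only [smul_eq_C_mul, derivative_C_mul, RingHom.id_apply]; ring

lemma jacobiOp_apply (α β : ℝ) (P : ℝ[X]) : jacobiOp α β P =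
    jacobiDrift α β * derivative P - (1 - X ^ 2) * derivative (derivative P) := rfl

lemma jacobiIntegral_jacobiOp_mul {α β : ℝ} (hα : -1 < α) (hβ : -1 < β) (P Q : ℝ[X]) :
    jacobiIntegral hα hβ (jacobiOp α β P * Q) =
      jacobiIntegral hα hβ ((1 - X ^ 2) * (derivative P * derivative Q)) := by
  have h := jacobiIntegral_mul_derivative hα hβ (derivative P * Q)
  have e₁ : jacobiOp α β P * Q = jacobiDrift α β * (derivative P * Q)
      - (1 - X ^ 2) * (derivative (derivative P) * Q) := by rw [jacobiOp_apply]; ring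
  rw [derivative_mul, mul_add, map_add] at h
  rw [e₁, map_sub]
  linarith

lemma jacobiIntegral_jacobiOp_comm {α β : ℝ} (hα : -1 < α) (hβ : -1 < β) (P Q : ℝ[X]) :
    jacobiIntegral hα hβ (jacobiOp α β P * Q) = jacobiIntegral hα hβ (P * jacobiOp α β Q) := by
  rw [mul_comm P, jacobiIntegral_jacobiOp_mul, jacobiIntegral_jacobiOp_mul,
    mul_comm (derivative P)]

/-- The eigenvalue of the Jacobi operator in degree `n`. -/
def jacobiEigenvalue (α β : ℝ) (n : ℕ) : ℝ := n * (n + α + β + 1)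

lemma jacobiEigenvalue_strictMono {α β : ℝ} (hα : -1 < α) (hβ : -1 < β) :
    StrictMono (jacobiEigenvalue α β) := by
  refine strictMono_nat_of_lt_succ fun n => ?_
  simp only [jacobiEigenvalue, Nat.cast_add, Nat.cast_one]
  nlinarith [(Nat.cast_nonneg n : (0 : ℝ) ≤ n)]

lemma coeff_jacobiOp (α β : ℝ) (P : ℝ[X]) (j : ℕ) :
    (jacobiOp α β P).coeff j = jacobiEigenvalue α β j * P.coeff j
      + (α - β) * (j + 1) * P.coeff (j + 1) - (j + 2) * (j + 1) * P.coeff (j + 2) := by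
  have e : jacobiOp α β P = C (α - β) * derivative P + C (α + β + 2) * (X * derivative P)
      - derivative (derivative P) + X ^ 2 * derivative (derivative P) := by
    rw [jacobiOp_apply, jacobiDrift]; ring
  rw [e, jacobiEigenvalue, coeff_add, coeff_sub, coeff_add, coeff_C_mul, coeff_C_mul]
  rcases j with _ | _ | j
  · simp [coeff_derivative]
    ring
  · simp [coeff_derivative, coeff_X_pow_mul']
    ring
  · simp [coeff_derivative, coeff_X_pow_mul']
    ring

lemma coeff_jacobiOp_sub_smul {α β : ℝ} {P : ℝ[X]} {k : ℕ} (n : ℕ)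
    (hP : ∀ j, k < j → P.coeff j = 0) :
    (jacobiOp α β P - jacobiEigenvalue α β n • P).coeff k =
      (jacobiEigenvalue α β k - jacobiEigenvalue α β n) * P.coeff k := by
  rw [coeff_sub, coeff_smul, coeff_jacobiOp, hP (k + 1) (by omega), hP (k + 2) (by omega),
    smul_eq_mul]
  ring

lemma jacobiOp_sub_smul_mem_degreeLT {α β : ℝ} {P : ℝ[X]} {n : ℕ} (hP : P.natDegree ≤ n) :
    jacobiOp α β P - jacobiEigenvalue α β n • P ∈ degreeLT ℝ n := by
  rw [mem_degreeLT, degree_lt_iff_coeff_zero]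
  intro k hk
  rw [coeff_jacobiOp_sub_smul n fun j hj => coeff_eq_zero_of_natDegree_lt (by omega)]
  rcases hk.eq_or_lt with rfl | hk
  · simp
  · rw [coeff_eq_zero_of_natDegree_lt (by omega), mul_zero]

lemma exists_jacobiOp_sub_smul_eq {α β : ℝ} (hα : -1 < α) (hβ : -1 < β) {n : ℕ} {Q : ℝ[X]}
    (hQ : Q ∈ degreeLT ℝ n) :
    ∃ R ∈ degreeLT ℝ n, jacobiOp α β R - jacobiEigenvalue α β n • R = Q := by
  let S : ℝ[X] →ₗ[ℝ] ℝ[X] := jacobiOp α β - jacobiEigenvalue α β n • LinearMap.id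
  have hS : ∀ R ∈ degreeLT ℝ n, S R ∈ degreeLT ℝ n := fun R hR =>
    jacobiOp_sub_smul_mem_degreeLT
      (natDegree_le_of_degree_le (mem_degreeLT.mp hR).le)
  have hinj : Function.Injective (S.restrict hS) := by
    rw [injective_iff_map_eq_zero]
    rintro ⟨R, hR⟩ h
    by_contra hne
    have hR₀ : R ≠ 0 := fun h₀ => hne (Subtype.ext h₀)
    have hSR : jacobiOp α β R - jacobiEigenvalue α β n • R = 0 := congrArg Subtype.val h
    have hc := coeff_jacobiOp_sub_smul (α := α) (β := β) (k := R.natDegree) n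
      fun j hj => coeff_eq_zero_of_natDegree_lt hj
    rw [hSR, coeff_zero, eq_comm, mul_eq_zero, sub_eq_zero] at hc
    rcases hc with hc | hc
    · have hlt := (natDegree_lt_iff_degree_lt hR₀).mpr (mem_degreeLT.mp hR)
      exact hlt.ne ((jacobiEigenvalue_strictMono hα hβ).injective hc)
    · exact hR₀ (leadingCoeff_eq_zero.mp hc)
  obtain ⟨⟨R, hR⟩, h⟩ := LinearMap.injective_iff_surjective.mp hinj ⟨Q, hQ⟩
  exact ⟨R, hR, congrArg Subtype.val h⟩

/-- Each degree carries a monic eigenpolynomial of the Jacobi operator. -/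
lemma exists_jacobi_eigenpolynomial {α β : ℝ} (hα : -1 < α) (hβ : -1 < β) (n : ℕ) :
    ∃ p : ℝ[X], X ^ n - p ∈ degreeLT ℝ n ∧ jacobiOp α β p = jacobiEigenvalue α β n • p := by
  obtain ⟨R, hR, h⟩ := exists_jacobiOp_sub_smul_eq hα hβ
    (jacobiOp_sub_smul_mem_degreeLT (α := α) (β := β) (natDegree_X_pow_le (R := ℝ) n))
  refine ⟨X ^ n - R, by simpa using hR, ?_⟩
  rw [map_sub, smul_sub]
  linear_combination -h

lemma jacobiIntegral_eigenpolynomial_mul {α β : ℝ} (hα : -1 < α) (hβ : -1 < β) {n : ℕ}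
    {p Q : ℝ[X]} (hp : jacobiOp α β p = jacobiEigenvalue α β n • p) (hQ : Q ∈ degreeLT ℝ n) :
    jacobiIntegral hα hβ (p * Q) = 0 := by
  obtain ⟨R, -, rfl⟩ := exists_jacobiOp_sub_smul_eq hα hβ hQ
  rw [mul_sub, map_sub, ← jacobiIntegral_jacobiOp_comm, hp, smul_mul_assoc, mul_smul_comm,
    sub_self]

/-- Rayleigh quotient bound for the Jacobi operator. -/
lemma jacobiIntegral_jacobiOp_mul_self_le {α β : ℝ} (hα : -1 < α) (hβ : -1 < β) (n : ℕ)
    {P : ℝ[X]} (hP : P.natDegree ≤ n) :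
    jacobiIntegral hα hβ (jacobiOp α β P * P) ≤
      jacobiEigenvalue α β n * jacobiIntegral hα hβ (P ^ 2) := by
  induction n generalizing P with
  | zero =>
    rw [eq_C_of_natDegree_le_zero hP, jacobiIntegral_jacobiOp_mul]
    simp [jacobiEigenvalue]
  | succ n ih =>
    obtain ⟨p, hp, hpe⟩ := exists_jacobi_eigenpolynomial hα hβ (n + 1)
    set a := P.coeff (n + 1)
    set R := P - a • p with hRdef
    have hR : R ∈ degreeLT ℝ (n + 1) := by
      have h₁ : P - a • X ^ (n + 1) ∈ degreeLT ℝ (n + 1) := by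
        rw [mem_degreeLT, degree_lt_iff_coeff_zero]
        intro k hk
        rcases hk.eq_or_lt with rfl | hk
        · simp [a]
        · simp [coeff_X_pow, hk.ne', coeff_eq_zero_of_natDegree_lt (hP.trans_lt hk)]
      have h₂ := add_mem h₁ (Submodule.smul_mem _ a hp)
      have e : R = P - a • X ^ (n + 1) + a • (X ^ (n + 1) - p) := by
        rw [hRdef, smul_sub]; abel
      rwa [e]
    have hRn : R.natDegree ≤ n := by
      rw [natDegree_le_iff_coeff_eq_zero]
      intro k hk
      exact (degree_lt_iff_coeff_zero _ _).mp (mem_degreeLT.mp hR) k hk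
    have hPR : P = C a * p + R := by rw [hRdef, smul_eq_C_mul]; ring
    have horth := jacobiIntegral_eigenpolynomial_mul hα hβ hpe hR
    have horth' : jacobiIntegral hα hβ (jacobiOp α β R * p) = 0 := by
      rw [jacobiIntegral_jacobiOp_comm, hpe, mul_smul_comm, map_smul, mul_comm, horth, smul_zero]
    set l := jacobiEigenvalue α β (n + 1)
    have e₁ : jacobiOp α β P * P = C (a ^ 2 * l) * p ^ 2 + C (a * l) * (p * R)
        + C a * (jacobiOp α β R * p) + jacobiOp α β R * R := by
      rw [hPR, map_add, ← smul_eq_C_mul a, map_smul, hpe]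
      simp only [smul_eq_C_mul, C_mul, C_pow]
      ring
    have e₂ : P ^ 2 = C (a ^ 2) * p ^ 2 + C (2 * a) * (p * R) + R ^ 2 := by
      rw [hPR]
      simp only [C_mul, C_pow, C_ofNat]
      ring
    rw [e₁, e₂]
    simp only [map_add, jacobiIntegral_C_mul, horth, horth']
    have hl : jacobiEigenvalue α β n ≤ l := (jacobiEigenvalue_strictMono hα hβ).monotone n.le_succ
    have := mul_le_mul_of_nonneg_right hl (jacobiIntegral_sq_nonneg hα hβ R)
    linarith [ih hRn]

/-- Bernstein-type inequality for the Jacobi weight. -/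
lemma jacobi_bernstein {α β : ℝ} (hα : -1 < α) (hβ : -1 < β) {n : ℕ} (hn : 1 ≤ n)
    {P : ℝ[X]} (hP : P.natDegree ≤ n) :
    jacobiIntegral hα hβ ((1 - X ^ 2) * derivative P ^ 2) ≤
      (α + β + 3) * n ^ 2 * jacobiIntegral hα hβ (P ^ 2) := by
  rw [sq (derivative P), ← jacobiIntegral_jacobiOp_mul]
  refine (jacobiIntegral_jacobiOp_mul_self_le hα hβ n hP).trans
    (mul_le_mul_of_nonneg_right ?_ (jacobiIntegral_sq_nonneg hα hβ P))
  have hn' : (1 : ℝ) ≤ n := by exact_mod_cast hn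
  have h : (n : ℝ) + α + β + 1 ≤ (α + β + 3) * n := by nlinarith
  rw [jacobiEigenvalue]
  nlinarith

lemma exists_pos_le_jacobiDrift_sq_add {α β : ℝ} (hα : -1 < α) (hβ : -1 < β) :
    ∃ c > 0, ∀ x ∈ Set.Icc (-1 : ℝ) 1, c ≤ (jacobiDrift α β).eval x ^ 2 + (1 - x ^ 2) := by
  obtain ⟨y, hy, hmin⟩ := (isCompact_Icc (a := (-1 : ℝ)) (b := 1)).exists_isMinOn
    (Set.nonempty_Icc.mpr (by norm_num))
    (f := fun x => (jacobiDrift α β).eval x ^ 2 + (1 - x ^ 2))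
    (by fun_prop)
  refine ⟨_, ?_, fun x hx => hmin hx⟩
  rcases hy.1.eq_or_lt with rfl | h₁
  · have : 0 < (β + 1) ^ 2 := pow_pos (by linarith) 2
    simp [jacobiDrift]
    nlinarith
  rcases hy.2.eq_or_lt with rfl | h₂
  · have : 0 < (α + 1) ^ 2 := pow_pos (by linarith) 2
    simp [jacobiDrift]
    nlinarith
  · have : 0 < 1 - y ^ 2 := by nlinarith
    positivity

lemma exists_pos_jacobiDrift_sq_le (α β : ℝ) :
    ∃ M > 0, ∀ x ∈ Set.Icc (-1 : ℝ) 1, (jacobiDrift α β).eval x ^ 2 ≤ M := by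
  obtain ⟨B, hB⟩ := (isCompact_Icc (a := (-1 : ℝ)) (b := 1)).exists_bound_of_continuousOn
    (f := fun x => (jacobiDrift α β).eval x ^ 2) (by fun_prop)
  exact ⟨max B 1, by positivity, fun x hx =>
    (le_abs_self _).trans ((hB x hx).trans (le_max_left _ _))⟩

lemma jacobiIntegral_drift_sq_mul_sq_le {α β : ℝ} (hα : -1 < α) (hβ : -1 < β) {M K : ℝ}
    (hM : ∀ x ∈ Set.Icc (-1 : ℝ) 1, (jacobiDrift α β).eval x ^ 2 ≤ M) (hK : 0 < K) (Q : ℝ[X]) :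
    jacobiIntegral hα hβ (jacobiDrift α β ^ 2 * Q ^ 2) ≤
      (α + β + 2 + K) * jacobiIntegral hα hβ ((1 - X ^ 2) * Q ^ 2)
        + M / K * jacobiIntegral hα hβ ((1 - X ^ 2) * derivative Q ^ 2) := by
  have h := jacobiIntegral_mul_derivative hα hβ (jacobiDrift α β * Q ^ 2)
  have hd : derivative (jacobiDrift α β) = C (α + β + 2) := by simp [jacobiDrift]
  rw [← mul_assoc, ← sq] at h
  rw [← h, ← jacobiIntegral_C_mul, ← jacobiIntegral_C_mul, ← map_add]
  refine jacobiIntegral_mono hα hβ fun x hx => ?_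
  rw [derivative_mul, hd, derivative_sq]
  simp only [eval_add, eval_mul, eval_sub, eval_pow, eval_one, eval_X, eval_C]
  have h₁ : 0 ≤ 1 - x ^ 2 := by nlinarith [hx.1, hx.2]
  set m := (jacobiDrift α β).eval x
  set q := Q.eval x
  set q' := (derivative Q).eval x
  have hamgm : 2 * (m * q * q') ≤ K * q ^ 2 + M / K * q' ^ 2 := by
    have h₂ : 2 * (m * q * q') ≤ K * q ^ 2 + m ^ 2 / K * q' ^ 2 := by
      have : K * q ^ 2 + m ^ 2 / K * q' ^ 2 - 2 * (m * q * q') = (K * q - m * q') ^ 2 / K := by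
        field_simp
        ring
      have : 0 ≤ (K * q - m * q') ^ 2 / K := by positivity
      linarith
    have h₃ : m ^ 2 / K * q' ^ 2 ≤ M / K * q' ^ 2 := by
      gcongr
      exact hM x hx
    linarith
  nlinarith [mul_le_mul_of_nonneg_left hamgm h₁]

/-- Schur-type inequality for the Jacobi weight: inserting the factor `1 - x²` costs at most
a factor of order `n²` on polynomials of degree at most `n`. -/
lemma jacobi_schur {α β : ℝ} (hα : -1 < α) (hβ : -1 < β) :
    ∃ E > 0, ∀ n : ℕ, 1 ≤ n → ∀ Q : ℝ[X], Q.natDegree ≤ n →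
      jacobiIntegral hα hβ (Q ^ 2) ≤
        E * n ^ 2 * jacobiIntegral hα hβ ((1 - X ^ 2) * Q ^ 2) := by
  obtain ⟨c, hc, hcb⟩ := exists_pos_le_jacobiDrift_sq_add hα hβ
  obtain ⟨M, hM, hMb⟩ := exists_pos_jacobiDrift_sq_le α β
  have hs : 0 < α + β + 3 := by linarith
  refine ⟨2 / c * (α + β + 3 + 2 * M * (α + β + 3) / c), by positivity, fun n hn Q hQ => ?_⟩
  have hn' : (1 : ℝ) ≤ n := by exact_mod_cast hn
  set K := 2 * M * (α + β + 3) * n ^ 2 / c with hKdef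
  have hK : 0 < K := by positivity
  have h₁ := jacobiIntegral_drift_sq_mul_sq_le hα hβ hMb hK Q
  have h₂ := mul_le_mul_of_nonneg_left (jacobi_bernstein hα hβ hn hQ)
    (show 0 ≤ M / K by positivity)
  have h₃ : c * jacobiIntegral hα hβ (Q ^ 2) ≤
      jacobiIntegral hα hβ (jacobiDrift α β ^ 2 * Q ^ 2)
        + jacobiIntegral hα hβ ((1 - X ^ 2) * Q ^ 2) := by
    rw [← jacobiIntegral_C_mul, ← map_add]
    refine jacobiIntegral_mono hα hβ fun x hx => ?_
    simp only [eval_add, eval_mul, eval_sub, eval_pow, eval_one, eval_X, eval_C]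
    rw [← add_mul]
    exact mul_le_mul_of_nonneg_right (hcb x hx) (sq_nonneg _)
  have hB : 0 ≤ jacobiIntegral hα hβ ((1 - X ^ 2) * Q ^ 2) := by
    rw [← map_zero (jacobiIntegral hα hβ)]
    refine jacobiIntegral_mono hα hβ fun x hx => ?_
    simp only [eval_mul, eval_sub, eval_pow, eval_one, eval_X, eval_zero]
    have : 0 ≤ 1 - x ^ 2 := by nlinarith [hx.1, hx.2]
    positivity
  set A := jacobiIntegral hα hβ (Q ^ 2)
  set B := jacobiIntegral hα hβ ((1 - X ^ 2) * Q ^ 2)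
  have h₄ : M / K * ((α + β + 3) * n ^ 2 * A) = c / 2 * A := by
    rw [hKdef]
    field_simp
  have h₅ : c / 2 * A ≤ (α + β + 3 + K) * B := by linarith
  have h₆ : α + β + 3 + K ≤ (α + β + 3 + 2 * M * (α + β + 3) / c) * n ^ 2 := by
    have : K = 2 * M * (α + β + 3) / c * n ^ 2 := by rw [hKdef]; ring
    have hsn : α + β + 3 ≤ (α + β + 3) * n ^ 2 := le_mul_of_one_le_right hs.le (one_le_pow₀ hn')
    linarith
  calc A = 2 / c * (c / 2 * A) := by field_simp
    _ ≤ 2 / c * ((α + β + 3 + 2 * M * (α + β + 3) / c) * n ^ 2 * B) := by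
      exact mul_le_mul_of_nonneg_left (h₅.trans (mul_le_mul_of_nonneg_right h₆ hB)) (by positivity)
    _ = _ := by ring

/-- Markov inequality for the Jacobi weight `w(x) = (1-x)^α (1+x)^β` on `[-1,1]`, `α, β > -1`. -/
theorem jacobi_markov (α β : ℝ) (hα : -1 < α) (hβ : -1 < β) :
    ∃ C : ℝ, 0 < C ∧ ∀ (n : ℕ) (P : Polynomial ℝ), P.natDegree ≤ n →
      L2w (Set.Icc (-1) 1) (fun x => (1 - x) ^ α * (1 + x) ^ β) (derivative P) ≤
        C * n ^ 2 * L2w (Set.Icc (-1) 1) (fun x => (1 - x) ^ α * (1 + x) ^ β) P := by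
  obtain ⟨E, hE, hEb⟩ := jacobi_schur hα hβ
  have hs : 0 < α + β + 3 := by linarith
  refine ⟨Real.sqrt (E * (α + β + 3)), by positivity, fun n P hP => ?_⟩
  rw [L2w_jacobi_eq_sqrt hα hβ, L2w_jacobi_eq_sqrt hα hβ]
  rcases Nat.eq_zero_or_pos n with rfl | hn
  · rw [eq_C_of_natDegree_le_zero hP]
    simp
  · have h : jacobiIntegral hα hβ (derivative P ^ 2) ≤
        E * (α + β + 3) * (n ^ 2) ^ 2 * jacobiIntegral hα hβ (P ^ 2) :=
      calc _ ≤ E * n ^ 2 * jacobiIntegral hα hβ ((1 - X ^ 2) * derivative P ^ 2) :=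
            hEb n hn _ ((natDegree_derivative_le P).trans ((Nat.sub_le _ _).trans hP))
        _ ≤ E * n ^ 2 * ((α + β + 3) * n ^ 2 * jacobiIntegral hα hβ (P ^ 2)) := by
            gcongr
            exact jacobi_bernstein hα hβ hn hP
        _ = _ := by ring
    refine (Real.sqrt_le_sqrt h).trans_eq ?_
    rw [Real.sqrt_mul (by positivity), Real.sqrt_mul (by positivity),
      Real.sqrt_sq (by positivity)]
end

section
/- Let α > −1 and c ≥ 0, and set w₂(x) := (x−c)^α e^{−x} on [c,∞). Then there exists a constant C_α > 0, depending only on α (and in particular independent of c and n), such that for every n ∈ ℕ and every polynomial P ∈ P_n, ‖P'‖_{L²([c,∞),w₂)} ≤ C_α · n · ‖P‖_{L²([c,∞),w₂)}. -/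
open MeasureTheory Polynomial

/-- Orthogonal projection onto the polynomials of degree less than `n`, for the bilinear form
`(P, Q) ↦ φ (P * Q)` of a positive definite functional `φ`. -/
theorem exists_projection_degree_lt (φ : ℝ[X] →ₗ[ℝ] ℝ) (hpos : ∀ p, p ≠ 0 → 0 < φ (p * p))
    (n : ℕ) : ∀ P : ℝ[X], ∃ Q : ℝ[X], Q.degree < n ∧
      ∀ R : ℝ[X], R.degree < n → φ ((P - Q) * R) = 0 := by
  induction n with
  | zero =>
    refine fun P => ⟨0, by simp, fun R hR => ?_⟩
    have hR0 : R = 0 := by simpa [Nat.WithBot.lt_zero_iff] using hR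
    simp [hR0]
  | succ n ih =>
    intro P
    obtain ⟨T, hT, hTo⟩ := ih (X ^ n)
    obtain ⟨Q, hQ, hQo⟩ := ih P
    set p : ℝ[X] := X ^ n - T with hp
    have hlt : ((n : ℕ) : WithBot ℕ) < ((n + 1 : ℕ) : WithBot ℕ) := by
      exact_mod_cast Nat.lt_succ_self n
    have hpn : p.coeff n = 1 := by
      simp [hp, coeff_eq_zero_of_degree_lt hT]
    have hp0 : p ≠ 0 := fun h => by simp [h] at hpn
    have hpd : p.degree < ((n + 1 : ℕ) : WithBot ℕ) :=
      (degree_sub_le _ _).trans_lt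
        (max_lt ((degree_X_pow_le n).trans_lt hlt) (hT.trans hlt))
    have hpp := (hpos p hp0).ne'
    set c : ℝ := φ (P * p) / φ (p * p) with hc
    refine ⟨Q + c • p, (degree_add_le _ _).trans_lt
      (max_lt (hQ.trans hlt) ((degree_smul_le c p).trans_lt hpd)), fun R hR => ?_⟩
    set r := R.coeff n with hr
    set S := R - r • p with hS
    have hSd : S.degree < n := by
      rw [degree_lt_iff_coeff_zero]
      intro m hm
      rcases hm.eq_or_lt with rfl | hm
      · simp [hS, hpn, hr]
      · have h1 := (degree_lt_iff_coeff_zero _ _).1 hR m hm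
        have h2 := (degree_lt_iff_coeff_zero _ _).1 hpd m hm
        simp [hS, h1, h2]
    have hR' : (P - (Q + c • p)) * R = (P - Q) * S - c • (p * S)
        + r • (P * p - p * Q - c • (p * p)) := by
      have : R = S + r • p := by simp [hS]
      rw [this]
      simp only [smul_eq_C_mul]
      ring
    rw [hR', map_add, map_sub, map_smul, map_smul, map_sub, map_sub, map_smul,
      hQo S hSd, hTo S hSd, hTo Q hQ, hc]
    simp only [smul_eq_mul]
    field_simp
    ring

/-- A polynomial of degree at most `k` orthogonal to all polynomials of smaller degree with respect
to a functional of Laguerre type satisfies `‖p'‖² = k / a * ‖p‖²`. -/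
theorem laguerre_functional_derivative_sq (φ : ℝ[X] →ₗ[ℝ] ℝ) (a : ℝ)
    (hibp : ∀ f : ℝ[X], φ (X * derivative f) + a * φ f = φ (X * f)) (k : ℕ) (p : ℝ[X])
    (hp : p.degree < ((k + 1 : ℕ) : WithBot ℕ))
    (ho : ∀ R : ℝ[X], R.degree < k → φ (p * R) = 0) :
    a * φ (derivative p * derivative p) = k * φ (p * p) := by
  have hc : ∀ m, k < m → p.coeff m = 0 := fun m hm => (degree_lt_iff_coeff_zero _ _).1 hp m hm
  have e0 : φ (p * (X * derivative p - (k : ℝ) • p)) = 0 := by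
    refine ho _ ((degree_lt_iff_coeff_zero _ _).2 fun m hm => ?_)
    rcases m with _ | m
    · obtain rfl : k = 0 := by simpa using hm
      simp
    · rcases hm.eq_or_lt with rfl | hm
      · simp [coeff_derivative]; ring
      · simp [coeff_derivative, hc _ hm]
  have e1 : φ (p * derivative p) = 0 :=
    ho _ ((degree_lt_iff_coeff_zero _ _).2 fun m hm => by
      simp [coeff_derivative, hc (m + 1) (by omega)])
  have e2 : φ (p * derivative (derivative p)) = 0 :=
    ho _ ((degree_lt_iff_coeff_zero _ _).2 fun m hm => by
      simp [coeff_derivative, hc (m + 1 + 1) (by omega)])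
  have e3 : φ (p * (X * derivative (derivative p))) = 0 := by
    refine ho _ ((degree_lt_iff_coeff_zero _ _).2 fun m hm => ?_)
    rcases m with _ | m
    · simp
    · simp [coeff_derivative, hc (m + 1 + 1) (by omega)]
  have e4 : φ (p * (X * derivative (derivative (derivative p)))) = 0 := by
    refine ho _ ((degree_lt_iff_coeff_zero _ _).2 fun m hm => ?_)
    rcases m with _ | m
    · simp
    · simp [coeff_derivative, hc (m + 1 + 1 + 1) (by omega)]
  have i1 := hibp (derivative p * derivative p)
  have i2 := hibp (p * derivative p)
  have i3 := hibp (p * derivative (derivative p))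
  have r1 : X * derivative (derivative p * derivative p)
      = (2 : ℝ) • (X * (derivative p * derivative (derivative p))) := by
    rw [derivative_mul, smul_eq_C_mul, map_ofNat]; ring
  have r2 : X * derivative (p * derivative p)
      = X * (derivative p * derivative p) + p * (X * derivative (derivative p)) := by
    rw [derivative_mul]; ring
  have r3 : X * derivative (p * derivative (derivative p))
      = X * (derivative p * derivative (derivative p))
        + p * (X * derivative (derivative (derivative p))) := by
    rw [derivative_mul]; ring
  rw [r1, map_smul, smul_eq_mul] at i1
  rw [r2, map_add, mul_left_comm X p] at i2
  rw [r3, map_add, mul_left_comm X p] at i3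
  rw [mul_sub, map_sub, mul_smul_comm, map_smul, smul_eq_mul] at e0
  rw [e1, e3] at i2
  rw [e2, e3, e4] at i3
  linarith

theorem laguerre_functional_markov (φ : ℝ[X] →ₗ[ℝ] ℝ) (a : ℝ) (ha : 0 < a)
    (hpos : ∀ p, p ≠ 0 → 0 < φ (p * p))
    (hibp : ∀ f : ℝ[X], φ (X * derivative f) + a * φ f = φ (X * f)) (n : ℕ) :
    ∀ P : ℝ[X], P.degree < ((n + 1 : ℕ) : WithBot ℕ) →
      a * φ (derivative P * derivative P) ≤ n * (n + 1) / 2 * φ (P * P) := by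
  induction n with
  | zero =>
    intro P hP
    have : derivative P = 0 := by
      ext m
      simp [coeff_derivative, (degree_lt_iff_coeff_zero _ _).1 hP (m + 1) (by omega)]
    simp [this]
  | succ n ih =>
    intro P hP
    obtain ⟨Q, hQ, ho⟩ := exists_projection_degree_lt φ hpos (n + 1) P
    obtain ⟨p, rfl⟩ : ∃ p, P = p + Q := ⟨P - Q, by simp⟩
    simp only [add_sub_cancel_right] at ho
    have hp : p.degree < ((n + 1 + 1 : ℕ) : WithBot ℕ) := by
      rw [← add_sub_cancel_right p Q]
      refine (degree_sub_le _ _).trans_lt (max_lt hP (hQ.trans ?_))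
      exact_mod_cast Nat.lt_succ_self (n + 1)
    have hk := laguerre_functional_derivative_sq φ a hibp (n + 1) p hp ho
    have hQ' := ih Q hQ
    have hpQ := ho Q hQ
    have hnn : ∀ q, 0 ≤ φ (q * q) := fun q => by
      rcases eq_or_ne q 0 with rfl | h
      · simp
      · exact (hpos q h).le
    have x1 : φ ((p + Q) * (p + Q)) = φ (p * p) + φ (Q * Q) := by
      have : (p + Q) * (p + Q) = p * p + (2 : ℝ) • (p * Q) + Q * Q := by
        rw [smul_eq_C_mul, map_ofNat]; ring
      rw [this, map_add, map_add, map_smul, hpQ]; simp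
    have x2 : φ (derivative (p + Q) * derivative (p + Q)) = φ (derivative p * derivative p)
        + 2 * φ (derivative p * derivative Q) + φ (derivative Q * derivative Q) := by
      have : derivative (p + Q) * derivative (p + Q) = derivative p * derivative p
          + (2 : ℝ) • (derivative p * derivative Q) + derivative Q * derivative Q := by
        rw [derivative_add, smul_eq_C_mul, map_ofNat]; ring
      rw [this, map_add, map_add, map_smul, smul_eq_mul]
    have hcs := hnn ((n : ℝ) • derivative p - (2 : ℝ) • derivative Q)
    have x3 : ((n : ℝ) • derivative p - (2 : ℝ) • derivative Q)
        * ((n : ℝ) • derivative p - (2 : ℝ) • derivative Q)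
        = ((n : ℝ) * n) • (derivative p * derivative p)
          - (4 * n : ℝ) • (derivative p * derivative Q)
          + (4 : ℝ) • (derivative Q * derivative Q) := by
      simp only [smul_eq_C_mul, map_mul, map_ofNat]; ring
    rw [x3, map_add, map_sub, map_smul, map_smul, map_smul] at hcs
    simp only [smul_eq_mul] at hcs
    rw [x1, x2]
    rcases Nat.eq_zero_or_pos n with rfl | hn
    · have : derivative Q = 0 := by
        by_contra h
        have := mul_pos ha (hpos _ h)
        simp at hQ'
        linarith
      simp only [this, mul_zero, map_zero, add_zero]
      rw [hk]
      push_cast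
      linarith [hnn Q]
    · have hn' : (0 : ℝ) < n := by exact_mod_cast hn
      push_cast at hk ⊢
      generalize φ (derivative p * derivative p) = u at *
      generalize φ (derivative p * derivative Q) = v at *
      generalize φ (derivative Q * derivative Q) = w at *
      generalize φ (p * p) = A at *
      generalize φ (Q * Q) = B at *
      have h1 : 0 ≤ a * (n * n * u - 4 * n * v + 4 * w) := mul_nonneg ha.le hcs
      refine le_of_mul_le_mul_left ?_ (mul_pos two_pos hn')
      nlinarith [mul_le_mul_of_nonneg_left hQ' (show (0 : ℝ) ≤ 2 * n + 4 by positivity)]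

theorem integrableOn_eval_mul_laguerre_weight {α : ℝ} (hα : -1 < α) (P : ℝ[X]) :
    IntegrableOn (fun x => P.eval x * (x ^ α * Real.exp (-x))) (Set.Ioi 0) := by
  induction P using Polynomial.induction_on' with
  | add p q hp hq => simpa only [eval_add, add_mul] using! hp.add hq
  | monomial n b =>
    have h := (Real.GammaIntegral_convergent (s := n + α + 1)
      (by have := n.cast_nonneg (α := ℝ); linarith)).const_mul b
    refine IntegrableOn.congr_fun h (fun x hx => ?_) measurableSet_Ioi
    have hx' : 0 < x := hx
    simp only [eval_monomial]
    rw [add_sub_cancel_right, Real.rpow_add hx', Real.rpow_natCast]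
    ring

/-- Integration of polynomials against the Laguerre weight. -/
noncomputable def laguerreFunctional (α : ℝ) (hα : -1 < α) : ℝ[X] →ₗ[ℝ] ℝ where
  toFun P := ∫ x in Set.Ioi 0, P.eval x * (x ^ α * Real.exp (-x))
  map_add' P Q := by
    rw [← integral_add (integrableOn_eval_mul_laguerre_weight hα P)
      (integrableOn_eval_mul_laguerre_weight hα Q)]
    simp [add_mul]
  map_smul' b P := by
    simp [mul_assoc, integral_const_mul]

theorem laguerreFunctional_monomial {α : ℝ} (hα : -1 < α) (n : ℕ) (b : ℝ) :
    laguerreFunctional α hα (monomial n b) = b * Real.Gamma (n + α + 1) := by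
  rw [Real.Gamma_eq_integral (by have := n.cast_nonneg (α := ℝ); linarith), ← integral_const_mul]
  refine setIntegral_congr_fun measurableSet_Ioi fun x hx => ?_
  have hx' : 0 < x := hx
  simp only [eval_monomial]
  rw [add_sub_cancel_right, Real.rpow_add hx', Real.rpow_natCast]
  ring

theorem laguerreFunctional_X_mul_derivative {α : ℝ} (hα : -1 < α) (P : ℝ[X]) :
    laguerreFunctional α hα (X * derivative P) + (α + 1) * laguerreFunctional α hα P
      = laguerreFunctional α hα (X * P) := by
  induction P using Polynomial.induction_on' with
  | add p q hp hq =>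
    simp only [mul_add, map_add] at *
    linarith
  | monomial n b =>
    have h : X * derivative (monomial n b) = monomial n (b * n) := by
      rcases n with _ | n
      · simp
      · simp [X_mul_monomial]
    have hn : (n : ℝ) + α + 1 ≠ 0 := by
      have := n.cast_nonneg (α := ℝ)
      linarith
    rw [h, X_mul_monomial]
    simp only [laguerreFunctional_monomial]
    have hG := Real.Gamma_add_one hn
    rw [show ((n + 1 : ℕ) : ℝ) + α + 1 = n + α + 1 + 1 by push_cast; ring, hG]
    ring

theorem laguerreFunctional_mul_self_pos {α : ℝ} (hα : -1 < α) (P : ℝ[X]) (hP : P ≠ 0) :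
    0 < laguerreFunctional α hα (P * P) := by
  refine (setIntegral_pos_iff_support_of_nonneg_ae ?_
    (integrableOn_eval_mul_laguerre_weight hα (P * P))).2 ?_
  · filter_upwards [ae_restrict_mem measurableSet_Ioi] with x hx
    have hx' : 0 < x := hx
    simp only [eval_mul, Pi.zero_apply]
    have := mul_self_nonneg (P.eval x)
    positivity
  · have hfin : (P.rootSet ℝ).Finite := P.rootSet_finite ℝ
    have hsub : Set.Ioi (0 : ℝ) \ P.rootSet ℝ ⊆
        Function.support (fun x => (P * P).eval x * (x ^ α * Real.exp (-x))) ∩ Set.Ioi 0 := by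
      rintro x ⟨hx, hxr⟩
      have hx' : 0 < x := hx
      have : P.eval x ≠ 0 := fun h => hxr (by simp [mem_rootSet, hP, h])
      refine ⟨?_, hx⟩
      simp only [Function.mem_support, eval_mul]
      positivity
    refine lt_of_lt_of_le ?_ (measure_mono hsub)
    rw [measure_sdiff_null (hfin.measure_zero _)]
    simp

theorem L2w_translated_laguerre {α : ℝ} (hα : -1 < α) (c : ℝ) (P : ℝ[X]) :
    L2w (Set.Ici c) (fun x => (x - c) ^ α * Real.exp (-x)) P =
      Real.sqrt (Real.exp (-c) *
        laguerreFunctional α hα (P.comp (X + C c) * P.comp (X + C c))) := by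
  unfold L2w
  congr 1
  have h := (measurePreserving_add_right volume c).setIntegral_preimage_emb
    (measurableEmbedding_addRight c)
    (fun x => P.eval x ^ 2 * ((x - c) ^ α * Real.exp (-x))) (Set.Ioi c)
  rw [integral_Ici_eq_integral_Ioi, ← h]
  simp only [Set.preimage_add_const_Ioi, sub_self]
  refine Eq.trans ?_ (integral_const_mul _ _)
  congr 1 with x
  simp only [add_sub_cancel_right, eval_mul, eval_comp, eval_add, eval_X, eval_C, neg_add,
    Real.exp_add]
  ring

/-- Markov inequality for the translated Laguerre weight `w₂(x) = (x-c)^α e^{-x}` on `[c,∞)`,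
with a constant depending only on `α` (independent of `c` and `n`). -/
theorem translated_laguerre_markov (α : ℝ) (hα : -1 < α) :
    ∃ C : ℝ, 0 < C ∧ ∀ (c : ℝ), 0 ≤ c → ∀ (n : ℕ) (P : Polynomial ℝ), P.natDegree ≤ n →
      L2w (Set.Ici c) (fun x => (x - c) ^ α * Real.exp (-x)) (derivative P) ≤
        C * n * L2w (Set.Ici c) (fun x => (x - c) ^ α * Real.exp (-x)) P := by
  have ha : 0 < α + 1 := by linarith
  refine ⟨Real.sqrt (1 / (α + 1)), by positivity, fun c _ n P hP => ?_⟩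
  rw [L2w_translated_laguerre hα, L2w_translated_laguerre hα]
  set Q := P.comp (X + C c) with hQ
  have hd : (derivative P).comp (X + C c) = derivative Q := by
    simp [hQ, derivative_comp]
  have hQd : Q.degree < ((n + 1 : ℕ) : WithBot ℕ) := by
    refine degree_le_natDegree.trans_lt ?_
    have : Q.natDegree < n + 1 := by
      rw [hQ, natDegree_comp, natDegree_X_add_C]
      omega
    exact_mod_cast this
  have hm := laguerre_functional_markov (laguerreFunctional α hα) (α + 1) ha
    (laguerreFunctional_mul_self_pos hα) (laguerreFunctional_X_mul_derivative hα) n Q hQd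
  have hnn : 0 ≤ laguerreFunctional α hα (Q * Q) := by
    rcases eq_or_ne Q 0 with h | h
    · simp [h]
    · exact (laguerreFunctional_mul_self_pos hα Q h).le
  have hnsq : (n : ℝ) * (n + 1) / 2 ≤ n ^ 2 := by
    have : (n : ℝ) ≤ n ^ 2 := by exact_mod_cast Nat.le_self_pow two_ne_zero n
    linarith
  rw [hd, ← Real.sqrt_sq n.cast_nonneg, ← Real.sqrt_mul (by positivity),
    ← Real.sqrt_mul (by positivity)]
  refine Real.sqrt_le_sqrt ?_
  rw [mul_left_comm]
  refine mul_le_mul_of_nonneg_left ?_ (Real.exp_pos _).le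
  rw [one_div, mul_assoc, le_inv_mul_iff₀ ha]
  exact hm.trans (mul_le_mul_of_nonneg_right hnsq hnn)
end

section
/- Let α, β be real numbers with q := max(α,β) ≥ −1/2 and q' := min(α,β) > −1. Then for every n ∈ ℕ and every polynomial P ∈ P_n, sup_{x∈[−1,1]} |P(x)| ≤ √( Γ(n+α+β+2) / (2^{α+β+1} Γ(q+1) Γ(n+q'+1)) · C(n+q+1, n) ) · ( ∫_{−1}^{1} |P(x)|² (1−x)^α (1+x)^β dx )^{1/2}, where C(n+q+1, n) = Γ(n+q+2)/(Γ(n+1)Γ(q+2)) is the generalized binomial coefficient and Γ is the Gamma function. -/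
open MeasureTheory Polynomial

/-- The rising factorial `x (x + 1) ⋯ (x + n - 1)` of a real number. -/
noncomputable abbrev risingFactorial (x : ℝ) (n : ℕ) : ℝ := (ascPochhammer ℝ n).eval x

theorem risingFactorial_succ_left (x : ℝ) (n : ℕ) :
    risingFactorial x (n + 1) = x * risingFactorial (x + 1) n := by
  simp [risingFactorial, ascPochhammer_succ_left]

theorem risingFactorial_pos {x : ℝ} (hx : 0 < x) (n : ℕ) : 0 < risingFactorial x n :=
  ascPochhammer_pos n x hx

theorem mul_risingFactorial_add_one (x : ℝ) (n : ℕ) :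
    x * risingFactorial (x + 1) n = risingFactorial x n * (x + n) := by
  rw [← risingFactorial_succ_left, risingFactorial, ascPochhammer_succ_eval]

/-- The Chu–Vandermonde identity. -/
theorem sum_choose_mul_risingFactorial_div (k : ℕ) (b : ℝ) {c : ℝ} (hc : 0 < c) :
    ∑ j ∈ Finset.range (k + 1),
        (-1) ^ j * (k.choose j : ℝ) * (risingFactorial b j / risingFactorial c j) =
      risingFactorial (c - b) k / risingFactorial c k := by
  induction k generalizing b c with
  | zero => simp [risingFactorial]
  | succ k ih =>
    have hsplit : ∑ j ∈ Finset.range (k + 1 + 1),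
        (-1) ^ j * ((k + 1).choose j : ℝ) * (risingFactorial b j / risingFactorial c j) =
        (∑ j ∈ Finset.range (k + 1),
          (-1) ^ j * (k.choose j : ℝ) * (risingFactorial b j / risingFactorial c j)) -
        b / c * ∑ j ∈ Finset.range (k + 1), (-1) ^ j * (k.choose j : ℝ) *
          (risingFactorial (b + 1) j / risingFactorial (c + 1) j) := by
      have hlast : ∑ j ∈ Finset.range (k + 1),
          (-1) ^ j * (k.choose j : ℝ) * (risingFactorial b j / risingFactorial c j) =
          ∑ j ∈ Finset.range (k + 1 + 1),
          (-1) ^ j * (k.choose j : ℝ) * (risingFactorial b j / risingFactorial c j) := by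
        rw [Finset.sum_range_succ _ (k + 1)]
        simp
      rw [hlast, Finset.sum_range_succ', Finset.sum_range_succ' _ (k + 1), Finset.mul_sum,
        add_sub_right_comm, ← Finset.sum_sub_distrib]
      congr 1
      · refine Finset.sum_congr rfl fun j _ => ?_
        rw [Nat.choose_succ_succ, risingFactorial_succ_left, risingFactorial_succ_left,
          mul_div_mul_comm]
        push_cast
        ring
      · simp
    rw [hsplit, ih b hc, ih (b + 1) (by linarith : 0 < c + 1), add_sub_add_right_eq_sub]
    have h1 : risingFactorial (c - b) (k + 1) = risingFactorial (c - b) k * (c - b + k) :=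
      ascPochhammer_succ_eval k _
    have h2 := mul_risingFactorial_add_one c k
    have h3 := (risingFactorial_pos hc k).ne'
    have h4 := (risingFactorial_pos (by linarith : 0 < c + 1) k).ne'
    rw [h1, risingFactorial_succ_left c]
    have h5 : risingFactorial (c - b) k / risingFactorial c k =
        risingFactorial (c - b) k * (c + k) / (c * risingFactorial (c + 1) k) := by
      rw [h2]
      field_simp
    rw [h5]
    field_simp
    ring

/-- The terminating hypergeometric polynomial `₂F₁(-k, b; c; X)`. -/
noncomputable def hypergeometricPoly (k : ℕ) (b c : ℝ) : ℝ[X] :=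
  ∑ j ∈ Finset.range (k + 1),
    C ((-1) ^ j * (k.choose j : ℝ) * (risingFactorial b j / risingFactorial c j)) * X ^ j

theorem coeff_hypergeometricPoly (k : ℕ) (b c : ℝ) (j : ℕ) :
    (hypergeometricPoly k b c).coeff j =
      (-1) ^ j * (k.choose j : ℝ) * (risingFactorial b j / risingFactorial c j) := by
  simp only [hypergeometricPoly, finsetSum_coeff, coeff_C_mul_X_pow]
  rw [Finset.sum_ite_eq]
  split_ifs with h
  · rfl
  · rw [Nat.choose_eq_zero_of_lt (by simpa using h)]
    simp

theorem natDegree_hypergeometricPoly_le (k : ℕ) (b c : ℝ) :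
    (hypergeometricPoly k b c).natDegree ≤ k := by
  refine natDegree_le_iff_coeff_eq_zero.2 fun j hj => ?_
  simp [coeff_hypergeometricPoly, Nat.choose_eq_zero_of_lt hj]

theorem eval_zero_hypergeometricPoly (k : ℕ) (b c : ℝ) :
    (hypergeometricPoly k b c).eval 0 = 1 := by
  simp [← coeff_zero_eq_eval_zero, coeff_hypergeometricPoly, risingFactorial]

theorem eval_one_hypergeometricPoly (k : ℕ) (b : ℝ) {c : ℝ} (hc : 0 < c) :
    (hypergeometricPoly k b c).eval 1 = risingFactorial (c - b) k / risingFactorial c k := by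
  rw [← sum_choose_mul_risingFactorial_div k b hc]
  simp [hypergeometricPoly, eval_finsetSum]

theorem coeff_X_mul_derivative (p : ℝ[X]) (j : ℕ) :
    (X * derivative p).coeff j = j * p.coeff j := by
  cases j with
  | zero => simp
  | succ j =>
    rw [coeff_X_mul, coeff_derivative]
    push_cast
    ring

/-- The hypergeometric differential equation. -/
theorem hypergeometricPoly_ode (k : ℕ) (b : ℝ) {c : ℝ} (hc : 0 < c) :
    X * (1 - X) * derivative (derivative (hypergeometricPoly k b c)) +
      (C c - C (b + 1 - k) * X) * derivative (hypergeometricPoly k b c) +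
      C (k * b) * hypergeometricPoly k b c = 0 := by
  set F := hypergeometricPoly k b c with hF
  have hrew : X * (1 - X) * derivative (derivative F) +
      (C c - C (b + 1 - k) * X) * derivative F + C (k * b) * F =
      derivative (X * derivative F) + C (c - 1) * derivative F -
        X * derivative (X * derivative F) - C (b - k) * (X * derivative F) + C (k * b) * F := by
    simp only [derivative_mul, derivative_X, C_sub, C_add, C_1]
    ring
  rw [hrew]
  ext j
  simp only [coeff_add, coeff_sub, coeff_C_mul, coeff_X_mul_derivative, coeff_derivative,
    coeff_zero]
  have hchoose : (k.choose (j + 1) : ℝ) * (j + 1) = k.choose j * (k - j) := by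
    rcases le_or_gt j k with h | h
    · have := Nat.choose_succ_right_eq k j
      rw [← Nat.cast_sub h]
      exact_mod_cast this
    · simp [Nat.choose_eq_zero_of_lt h, Nat.choose_eq_zero_of_lt (h.trans (Nat.lt_succ_self j))]
  have hcj : 0 < c + j := by positivity
  have hrec : F.coeff (j + 1) * (j + 1) * (c + j) = F.coeff j * (j - k) * (b + j) := by
    have h3 := (risingFactorial_pos hc j).ne'
    rw [hF, coeff_hypergeometricPoly, coeff_hypergeometricPoly]
    simp only [risingFactorial] at h3 ⊢
    rw [ascPochhammer_succ_eval, ascPochhammer_succ_eval]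
    field_simp
    linear_combination (-1) ^ (j + 1) * (b + j) * eval b (ascPochhammer ℝ j) * hchoose
  push_cast
  linear_combination hrec

theorem risingFactorial_mono {x y : ℝ} (hx : 0 < x) (hxy : x ≤ y) (n : ℕ) :
    risingFactorial x n ≤ risingFactorial y n := by
  induction n with
  | zero => simp [risingFactorial]
  | succ n ih =>
    have h1 := (risingFactorial_pos (hx.trans_le hxy) n).le
    simp only [risingFactorial] at ih h1 ⊢
    rw [ascPochhammer_succ_eval, ascPochhammer_succ_eval]
    gcongr

/-- The Jacobi polynomial on `[0, 1]` for the weight `t ^ (u - 1) * (1 - t) ^ (v - 1)`, normalized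
to take the value `1` at `0`. -/
noncomputable def shiftedJacobi (u v : ℝ) (k : ℕ) : ℝ[X] :=
  hypergeometricPoly k (k + u + v - 1) u

theorem eval_zero_shiftedJacobi (u v : ℝ) (k : ℕ) : (shiftedJacobi u v k).eval 0 = 1 :=
  eval_zero_hypergeometricPoly _ _ _

theorem abs_eval_one_shiftedJacobi_le {u v : ℝ} (hv : 0 < v) (hvu : v ≤ u) (k : ℕ) :
    |(shiftedJacobi u v k).eval 1| ≤ 1 := by
  have hu : 0 < u := hv.trans_le hvu
  have hval : risingFactorial (u - (k + u + v - 1)) k = (-1) ^ k * risingFactorial v k := by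
    have h := ascPochhammer_eval_neg_eq_descPochhammer ℝ (v + k - 1) k
    rw [descPochhammer_eval_eq_ascPochhammer] at h
    rw [risingFactorial, risingFactorial]
    convert! h using 2 <;> ring_nf
  rw [shiftedJacobi, eval_one_hypergeometricPoly _ _ hu, hval, abs_div, abs_mul, abs_pow, abs_neg,
    abs_one, one_pow, one_mul, abs_of_pos (risingFactorial_pos hv k),
    abs_of_pos (risingFactorial_pos hu k), div_le_one (risingFactorial_pos hu k)]
  exact risingFactorial_mono hv hvu k

/-- The Sonine function `F² + t (1 - t) F'² / λ` of a solution of the hypergeometric equation with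
eigenvalue `λ` has an explicit derivative. -/
theorem hasDerivAt_sonine_shiftedJacobi {u v : ℝ} (hu : 0 < u) (k : ℕ)
    (hlam : (k : ℝ) * (k + u + v - 1) ≠ 0) (t : ℝ) :
    HasDerivAt (fun t => (shiftedJacobi u v k).eval t ^ 2 +
        t * (1 - t) / (k * (k + u + v - 1)) * (derivative (shiftedJacobi u v k)).eval t ^ 2)
      ((derivative (shiftedJacobi u v k)).eval t ^ 2 / (k * (k + u + v - 1)) *
        (2 * (u + v - 1) * t - (2 * u - 1))) t := by
  set F := shiftedJacobi u v k with hF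
  set l : ℝ := k * (k + u + v - 1) with hl
  have hode := congrArg (eval t) (hypergeometricPoly_ode k (k + u + v - 1) hu)
  rw [← shiftedJacobi, ← hF] at hode
  simp only [eval_add, eval_mul, eval_sub, eval_X, eval_C, eval_one, eval_zero] at hode
  rw [← hl] at hode
  have h := ((F.hasDerivAt t).pow 2).add ((((hasDerivAt_id t).mul
    ((hasDerivAt_id t).const_sub 1)).div_const l).mul (((derivative F).hasDerivAt t).pow 2))
  refine (h.congr_deriv ?_)
  simp only [id, Pi.mul_apply]
  field_simp
  norm_num
  linear_combination 2 * (derivative F).eval t * hode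

theorem abs_eval_shiftedJacobi_le {u v : ℝ} (hv : 0 < v) (hvu : v ≤ u) (hu : 1 / 2 ≤ u) (k : ℕ)
    {t : ℝ} (ht : t ∈ Set.Icc (0 : ℝ) 1) : |(shiftedJacobi u v k).eval t| ≤ 1 := by
  rcases Nat.eq_zero_or_pos k with rfl | hk
  · simp [shiftedJacobi, hypergeometricPoly, risingFactorial]
  have hk' : (1 : ℝ) ≤ k := by exact_mod_cast hk
  have hlam : 0 < (k : ℝ) * (k + u + v - 1) := by
    apply mul_pos <;> linarith
  have hder := hasDerivAt_sonine_shiftedJacobi (v := v) (by linarith) k hlam.ne'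
  set g : ℝ → ℝ := fun t => (shiftedJacobi u v k).eval t ^ 2 +
        t * (1 - t) / (k * (k + u + v - 1)) * (derivative (shiftedJacobi u v k)).eval t ^ 2 with hg
  have hcont : Continuous g := continuous_iff_continuousAt.2 fun t => (hder t).continuousAt
  have hle : (shiftedJacobi u v k).eval t ^ 2 ≤ g t := by
    have : 0 ≤ t * (1 - t) := mul_nonneg ht.1 (by linarith [ht.2])
    rw [hg]
    exact le_add_of_nonneg_right (by positivity)
  have hg0 : g 0 ≤ 1 := by simp [hg, eval_zero_shiftedJacobi]
  have hg1 : g 1 ≤ 1 := by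
    simpa [hg] using abs_eval_one_shiftedJacobi_le hv hvu k
  rw [← sq_le_one_iff_abs_le_one]
  refine hle.trans ?_
  rcases le_or_gt (2 * (u + v - 1) * t) (2 * u - 1) with h | h
  · refine le_trans ?_ hg0
    refine antitoneOn_of_deriv_nonpos (convex_Icc 0 t) hcont.continuousOn
      (fun s _ => (hder s).differentiableAt.differentiableWithinAt) (fun s hs => ?_)
      (Set.left_mem_Icc.2 ht.1) (Set.right_mem_Icc.2 ht.1) ht.1
    rw [interior_Icc] at hs
    rw [(hder s).deriv]
    refine mul_nonpos_of_nonneg_of_nonpos (by positivity) ?_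
    rcases le_total 0 (u + v - 1) with h0 | h0 <;> nlinarith [hs.1, hs.2]
  · refine le_trans ?_ hg1
    refine monotoneOn_of_deriv_nonneg (convex_Icc t 1) hcont.continuousOn
      (fun s _ => (hder s).differentiableAt.differentiableWithinAt) (fun s hs => ?_)
      (Set.left_mem_Icc.2 ht.2) (Set.right_mem_Icc.2 ht.2) ht.2
    rw [interior_Icc] at hs
    rw [(hder s).deriv]
    refine mul_nonneg (by positivity) ?_
    rcases le_total 0 (u + v - 1) with h0 | h0 <;> nlinarith [hs.1, hs.2, ht.1]

theorem intervalIntegrable_jacobiWeight_and_integral {u v : ℝ} (hu : 0 < u) (hv : 0 < v) :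
    IntervalIntegrable (fun t : ℝ => t ^ (u - 1) * (1 - t) ^ (v - 1)) volume 0 1 ∧
      ∫ t in (0 : ℝ)..1, t ^ (u - 1) * (1 - t) ^ (v - 1) = ProbabilityTheory.beta u v := by
  have hcast : Set.EqOn (fun t : ℝ => (t : ℂ) ^ ((u : ℂ) - 1) * (1 - (t : ℂ)) ^ ((v : ℂ) - 1))
      (fun t : ℝ => ((t ^ (u - 1) * (1 - t) ^ (v - 1) : ℝ) : ℂ)) (Set.Icc 0 1) := by
    intro t ht
    have ht' : 0 ≤ 1 - t := by linarith [ht.2]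
    simp only
    rw [Complex.ofReal_mul, Complex.ofReal_cpow ht.1, Complex.ofReal_cpow ht']
    push_cast
    rfl
  have huIcc : Set.uIcc (0 : ℝ) 1 = Set.Icc 0 1 := Set.uIcc_of_le zero_le_one
  constructor
  · have h := Complex.betaIntegral_convergent (u := u) (v := v) (by simpa) (by simpa)
    rw [intervalIntegrable_iff] at h ⊢
    have h' := (h.congr_fun (fun t ht => hcast (huIcc ▸ Set.uIoc_subset_uIcc ht))
      measurableSet_uIoc).re
    simpa [IntegrableOn] using h'
  · rw [ProbabilityTheory.beta_eq_betaIntegralReal u v hu hv, Complex.betaIntegral,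
      intervalIntegral.integral_congr (fun t ht => hcast (huIcc ▸ ht)),
      intervalIntegral.integral_ofReal, Complex.ofReal_re]

/-- Integration of polynomials against the weight `t ^ (u - 1) * (1 - t) ^ (v - 1)` on `[0, 1]`. -/
noncomputable def jacobiFunctional {u v : ℝ} (hu : 0 < u) (hv : 0 < v) : ℝ[X] →ₗ[ℝ] ℝ where
  toFun p := ∫ t in (0 : ℝ)..1, p.eval t * (t ^ (u - 1) * (1 - t) ^ (v - 1))
  map_add' p q := by
    have hint (p : ℝ[X]) := (intervalIntegrable_jacobiWeight_and_integral hu hv).1.continuousOn_mul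
      (p.continuousOn (s := Set.uIcc 0 1))
    simp only [eval_add, add_mul]
    exact intervalIntegral.integral_add (hint p) (hint q)
  map_smul' a p := by
    simp only [eval_smul, smul_eq_mul, mul_assoc, intervalIntegral.integral_const_mul,
      RingHom.id_apply]

theorem jacobiFunctional_apply {u v : ℝ} (hu : 0 < u) (hv : 0 < v) (p : ℝ[X]) :
    jacobiFunctional hu hv p =
      ∫ t in (0 : ℝ)..1, p.eval t * (t ^ (u - 1) * (1 - t) ^ (v - 1)) := rfl

theorem jacobiFunctional_X_pow_mul_one_sub_X_pow {u v : ℝ} (hu : 0 < u) (hv : 0 < v) (j m : ℕ) :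
    jacobiFunctional hu hv (X ^ j * (1 - X) ^ m) = ProbabilityTheory.beta (u + j) (v + m) := by
  rw [jacobiFunctional_apply,
    ← (intervalIntegrable_jacobiWeight_and_integral (by positivity : 0 < u + j)
      (by positivity : 0 < v + m)).2, intervalIntegral.integral_of_le zero_le_one,
    intervalIntegral.integral_of_le zero_le_one, integral_Ioc_eq_integral_Ioo,
    integral_Ioc_eq_integral_Ioo]
  refine setIntegral_congr_fun measurableSet_Ioo fun t ht => ?_
  have ht' : 0 < 1 - t := by linarith [ht.2]
  simp only [eval_mul, eval_pow, eval_X, eval_sub, eval_one]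
  rw [add_sub_right_comm, Real.rpow_add_natCast ht.1.ne', add_sub_right_comm,
    Real.rpow_add_natCast ht'.ne']
  ring

theorem Gamma_add_natCast_eq_mul_risingFactorial {u : ℝ} (hu : 0 < u) (j : ℕ) :
    Real.Gamma (u + j) = Real.Gamma u * risingFactorial u j := by
  induction j with
  | zero => simp [risingFactorial]
  | succ j ih =>
    rw [Nat.cast_succ, ← add_assoc, Real.Gamma_add_one (by positivity), ih]
    simp only [risingFactorial]
    rw [ascPochhammer_succ_eval]
    ring

theorem beta_add_natCast {u w : ℝ} (hu : 0 < u) (hw : 0 < w) (j : ℕ) :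
    ProbabilityTheory.beta (u + j) w =
      ProbabilityTheory.beta u w * (risingFactorial u j / risingFactorial (u + w) j) := by
  rw [ProbabilityTheory.beta, ProbabilityTheory.beta, add_right_comm,
    Gamma_add_natCast_eq_mul_risingFactorial hu,
    Gamma_add_natCast_eq_mul_risingFactorial (add_pos hu hw)]
  ring

theorem jacobiFunctional_shiftedJacobi_mul_one_sub_X_pow {u v : ℝ} (hu : 0 < u) (hv : 0 < v)
    (k m : ℕ) :
    jacobiFunctional hu hv (shiftedJacobi u v k * (1 - X) ^ m) =
      ProbabilityTheory.beta u (v + m) *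
        (risingFactorial (m + 1 - k) k / risingFactorial (u + (v + m)) k) := by
  have hw : 0 < v + m := by positivity
  have h := sum_choose_mul_risingFactorial_div k (k + u + v - 1) (add_pos hu hw)
  rw [show u + (v + m) - (k + u + v - 1) = (m : ℝ) + 1 - k by ring] at h
  rw [← h, shiftedJacobi, hypergeometricPoly, Finset.sum_mul, map_sum, Finset.mul_sum]
  refine Finset.sum_congr rfl fun j _ => ?_
  rw [mul_assoc, ← smul_eq_C_mul, map_smul, jacobiFunctional_X_pow_mul_one_sub_X_pow,
    beta_add_natCast hu hw, smul_eq_mul]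
  have := (risingFactorial_pos hu j).ne'
  field_simp

theorem natDegree_one_sub_X : (1 - X : ℝ[X]).natDegree = 1 := by
  rw [← natDegree_neg, neg_sub]
  exact natDegree_X_sub_C 1

theorem jacobiFunctional_shiftedJacobi_mul_eq_zero {u v : ℝ} (hu : 0 < u) (hv : 0 < v) {k : ℕ}
    {Q : ℝ[X]} (hQ : Q.degree < k) : jacobiFunctional hu hv (shiftedJacobi u v k * Q) = 0 := by
  rcases eq_or_ne Q 0 with rfl | hQ0
  · simp
  have hQ' : Q.natDegree < k := (natDegree_lt_iff_degree_lt hQ0).2 hQ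
  have hR : (Q.comp (1 - X)).natDegree < k := by
    rwa [natDegree_comp, natDegree_one_sub_X, mul_one]
  have hQR : Q = (Q.comp (1 - X)).comp (1 - X) := by simp [comp_assoc]
  rw [hQR, (Q.comp (1 - X)).as_sum_range' k hR]
  simp only [Polynomial.sum_comp, monomial_comp, Finset.mul_sum, map_sum]
  refine Finset.sum_eq_zero fun m hm => ?_
  have hneg : ((m : ℝ) + 1 - k) = -((k - 1 - m : ℕ) : ℝ) := by
    rw [Nat.cast_sub, Nat.cast_sub] <;> grind
  rw [mul_left_comm, ← smul_eq_C_mul, map_smul, jacobiFunctional_shiftedJacobi_mul_one_sub_X_pow,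
    hneg, risingFactorial, ascPochhammer_eval_neg_coe_nat_of_lt (by grind)]
  simp

theorem jacobiFunctional_shiftedJacobi_sq {u v : ℝ} (hu : 0 < u) (hv : 0 < v) (k : ℕ) :
    jacobiFunctional hu hv (shiftedJacobi u v k * shiftedJacobi u v k) =
      risingFactorial (k + u + v - 1) k / risingFactorial u k *
        (ProbabilityTheory.beta u (v + k) * (Real.Gamma (k + 1) /
          risingFactorial (u + (v + k)) k)) := by
  set F := shiftedJacobi u v k with hF
  set a := risingFactorial (k + u + v - 1) k / risingFactorial u k with ha
  have hlow : (F - C a * (1 - X) ^ k).degree < (k : WithBot ℕ) := by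
    refine (degree_lt_iff_coeff_zero _ _).2 fun m hm => ?_
    have hpow : ((1 - X : ℝ[X]) ^ k).natDegree ≤ k := by
      rw [natDegree_pow, natDegree_one_sub_X, mul_one]
    have hdeg : F.natDegree ≤ k := natDegree_hypergeometricPoly_le _ _ _
    rcases hm.eq_or_lt with rfl | hm
    · have htop := coeff_pow_of_natDegree_le (m := k) natDegree_one_sub_X.le
      rw [mul_one] at htop
      rw [coeff_sub, coeff_C_mul, htop, hF, shiftedJacobi, coeff_hypergeometricPoly,
        Nat.choose_self, ha]
      simp [coeff_one, mul_comm]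
    · rw [coeff_sub, coeff_C_mul, coeff_eq_zero_of_natDegree_lt (hpow.trans_lt hm),
        coeff_eq_zero_of_natDegree_lt (hdeg.trans_lt hm)]
      simp
  have hsplit : F * F = F * (F - C a * (1 - X) ^ k) + a • (F * (1 - X) ^ k) := by
    rw [smul_eq_C_mul]
    ring
  rw [hsplit, map_add, hF, jacobiFunctional_shiftedJacobi_mul_eq_zero hu hv hlow, map_smul,
    jacobiFunctional_shiftedJacobi_mul_one_sub_X_pow, zero_add, smul_eq_mul, add_sub_cancel_left,
    risingFactorial, ascPochhammer_eval_one, Real.Gamma_nat_eq_factorial]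

/-- The diagonal value at `0` of the reproducing kernel of the polynomials of degree at most `n`
for the weight `t ^ (u - 1) * (1 - t) ^ (v - 1)` on `[0, 1]`. -/
noncomputable def jacobiKernelConst (u v : ℝ) (n : ℕ) : ℝ :=
  Real.Gamma (n + u + v) * Real.Gamma (n + u + 1) /
    (Real.Gamma u * Real.Gamma (n + v) * (Real.Gamma (n + 1) * Real.Gamma (u + 1)))

theorem jacobiKernelConst_zero {u v : ℝ} (hu : 0 < u) :
    jacobiKernelConst u v 0 = (ProbabilityTheory.beta u v)⁻¹ := by
  have h := (Real.Gamma_pos_of_pos (by linarith : 0 < u + 1)).ne'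
  rw [jacobiKernelConst, ProbabilityTheory.beta]
  simp only [Nat.cast_zero, zero_add, Real.Gamma_one]
  field_simp

theorem jacobiKernelConst_succ {u v : ℝ} (hu : 0 < u) (hv : 0 < v) (n : ℕ) :
    jacobiKernelConst u v (n + 1) = jacobiKernelConst u v n +
      (jacobiFunctional hu hv (shiftedJacobi u v (n + 1) * shiftedJacobi u v (n + 1)))⁻¹ := by
  have hGu := Real.Gamma_pos_of_pos hu
  have hGuv := Real.Gamma_pos_of_pos (by positivity : 0 < n + u + v)
  have hGn := Real.Gamma_pos_of_pos (by positivity : (0 : ℝ) < n + 1)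
  have hGv := Real.Gamma_pos_of_pos (by positivity : 0 < n + v)
  have hGnu := Real.Gamma_pos_of_pos (by positivity : 0 < n + u)
  have hr := risingFactorial_pos (by positivity : 0 < n + u + v + 1) (n + 1)
  have hrise : risingFactorial (n + u + v) (n + 1) =
      (n + u + v) * risingFactorial (n + u + v + 1) (n + 1) / (n + u + v + (n + 1)) := by
    have h := mul_risingFactorial_add_one (n + u + v) (n + 1)
    push_cast at h
    rw [h]
    have : 0 < n + u + v + (n + 1) := by positivity
    field_simp
  have hru : risingFactorial u (n + 1) = (n + u) * Real.Gamma (n + u) / Real.Gamma u := by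
    have h := Gamma_add_natCast_eq_mul_risingFactorial hu (n + 1)
    rw [← Real.Gamma_add_one (by positivity)]
    push_cast at h
    rw [show (n : ℝ) + u + 1 = u + (n + 1) by ring, h]
    field_simp
  rw [jacobiFunctional_shiftedJacobi_sq, jacobiKernelConst, jacobiKernelConst,
    ProbabilityTheory.beta]
  push_cast
  rw [show (n : ℝ) + 1 + u + v - 1 = n + u + v by ring, hrise, hru,
    show u + (v + ((n : ℝ) + 1)) = n + u + v + 1 by ring,
    show v + ((n : ℝ) + 1) = n + v + 1 by ring,
    show (n : ℝ) + 1 + u + v = n + u + v + 1 by ring,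
    show (n : ℝ) + 1 + u + 1 = n + u + 1 + 1 by ring,
    show (n : ℝ) + 1 + v = n + v + 1 by ring,
    Real.Gamma_add_one (by positivity : (n : ℝ) + u + v ≠ 0),
    Real.Gamma_add_one (by positivity : (n : ℝ) + u + 1 ≠ 0),
    Real.Gamma_add_one (by positivity : (n : ℝ) + u ≠ 0),
    Real.Gamma_add_one (by positivity : (n : ℝ) + v ≠ 0),
    Real.Gamma_add_one (by positivity : (n : ℝ) + 1 ≠ 0),
    Real.Gamma_add_one hu.ne']
  have h1 : 0 < n + u + v := by positivity
  have h2 : 0 < n + u + v + (n + 1) := by positivity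
  have h3 : 0 < n + u := by positivity
  have h4 : 0 < n + v := by positivity
  field_simp
  ring

theorem jacobiFunctional_shiftedJacobi_sq_pos {u v : ℝ} (hu : 0 < u) (hv : 0 < v) (n : ℕ) :
    0 < jacobiFunctional hu hv (shiftedJacobi u v (n + 1) * shiftedJacobi u v (n + 1)) := by
  rw [jacobiFunctional_shiftedJacobi_sq]
  have h1 := risingFactorial_pos (x := ((n + 1 : ℕ) : ℝ) + u + v - 1)
    (by push_cast; linarith [n.cast_nonneg (α := ℝ)]) (n + 1)
  have h2 := risingFactorial_pos hu (n + 1)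
  have h3 := ProbabilityTheory.beta_pos hu (by positivity : 0 < v + (n + 1 : ℕ))
  have h4 := Real.Gamma_pos_of_pos (by positivity : (0 : ℝ) < (n + 1 : ℕ) + 1)
  have h5 := risingFactorial_pos (by positivity : 0 < u + (v + (n + 1 : ℕ))) (n + 1)
  positivity

theorem jacobiKernelConst_pos {u v : ℝ} (hu : 0 < u) (hv : 0 < v) (n : ℕ) :
    0 < jacobiKernelConst u v n := by
  have h1 := Real.Gamma_pos_of_pos hu
  have h2 := Real.Gamma_pos_of_pos (by positivity : 0 < n + u + v)
  have h3 := Real.Gamma_pos_of_pos (by positivity : (0 : ℝ) < n + 1)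
  have h4 := Real.Gamma_pos_of_pos (by positivity : 0 < n + v)
  have h5 := Real.Gamma_pos_of_pos (by positivity : 0 < n + u + 1)
  have h6 := Real.Gamma_pos_of_pos (by positivity : 0 < u + 1)
  rw [jacobiKernelConst]
  positivity

/-- Lupaş' inequality on `[0, 1]`, in squared form. -/
theorem eval_sq_le_jacobiKernelConst_mul {u v : ℝ} (hu : 0 < u) (hv : 0 < v) (hvu : v ≤ u)
    (hu' : 1 / 2 ≤ u) {t : ℝ} (ht : t ∈ Set.Icc (0 : ℝ) 1) {n : ℕ} {P : ℝ[X]}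
    (hP : P.natDegree ≤ n) :
    P.eval t ^ 2 ≤ jacobiKernelConst u v n * jacobiFunctional hu hv (P * P) := by
  induction n generalizing P with
  | zero =>
    obtain ⟨c, rfl⟩ : ∃ c, C c = P := ⟨_, (eq_C_of_natDegree_le_zero hP).symm⟩
    have hone : jacobiFunctional hu hv 1 = ProbabilityTheory.beta u v := by
      simpa using jacobiFunctional_X_pow_mul_one_sub_X_pow hu hv 0 0
    have hbeta := (ProbabilityTheory.beta_pos hu hv).ne'
    have hCC : (C c * C c : ℝ[X]) = (c ^ 2) • 1 := by
      rw [← C_mul, smul_eq_C_mul, mul_one, sq]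
    rw [hCC, map_smul, hone, jacobiKernelConst_zero hu, eval_C, smul_eq_mul]
    field_simp
    rfl
  | succ n ih =>
    set F := shiftedJacobi u v (n + 1) with hF
    have hFdeg : F.natDegree ≤ n + 1 := natDegree_hypergeometricPoly_le _ _ _
    have hFtop : F.coeff (n + 1) ≠ 0 := by
      have h1 := risingFactorial_pos (x := ((n + 1 : ℕ) : ℝ) + u + v - 1)
        (by push_cast; linarith [n.cast_nonneg (α := ℝ)]) (n + 1)
      have h2 := risingFactorial_pos hu (n + 1)
      rw [hF, shiftedJacobi, coeff_hypergeometricPoly, Nat.choose_self]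
      simp only [ne_eq, mul_eq_zero, div_eq_zero_iff, not_or]
      exact ⟨⟨by simp, by simp⟩, h1.ne', h2.ne'⟩
    set c := P.coeff (n + 1) / F.coeff (n + 1) with hc
    set R := P - C c * F with hR
    have hRdeg : R.natDegree ≤ n := by
      refine natDegree_le_iff_coeff_eq_zero.2 fun m hm => ?_
      rw [hR, coeff_sub, coeff_C_mul]
      rcases (Nat.succ_le_of_lt hm).eq_or_lt with h | h
      · rw [← h, hc]
        field_simp
        ring
      · rw [coeff_eq_zero_of_natDegree_lt (hP.trans_lt h),
          coeff_eq_zero_of_natDegree_lt (hFdeg.trans_lt h)]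
        simp
    have horth : jacobiFunctional hu hv (F * R) = 0 :=
      jacobiFunctional_shiftedJacobi_mul_eq_zero hu hv
        ((degree_le_of_natDegree_le hRdeg).trans_lt (by exact_mod_cast n.lt_succ_self))
    have hPR : P = R + C c * F := by rw [hR]; ring
    have hPP : P * P = R * R + (2 * c) • (F * R) + (c ^ 2) • (F * F) := by
      rw [hPR, smul_eq_C_mul, smul_eq_C_mul]
      simp only [C_mul, C_pow, C_ofNat]
      ring
    have hFt := abs_eval_shiftedJacobi_le hv hvu hu' (n + 1) ht
    rw [← hF, ← sq_le_one_iff_abs_le_one] at hFt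
    have hh := jacobiFunctional_shiftedJacobi_sq_pos hu hv n
    have hK := jacobiKernelConst_pos hu hv n
    have hRt := ih hRdeg
    rw [hPP, map_add, map_add, map_smul, map_smul, horth, jacobiKernelConst_succ hu hv, ← hF,
      hPR, eval_add, eval_mul, eval_C]
    rw [← hF] at hh
    set h := jacobiFunctional hu hv (F * F)
    set K := jacobiKernelConst u v n
    set r := R.eval t
    set f := F.eval t
    set I := jacobiFunctional hu hv (R * R)
    simp only [smul_eq_mul, mul_zero, add_zero]
    have hcross : 2 * (r * (c * f)) ≤ h⁻¹ * I + K * (c ^ 2 * h) := by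
      have h1 : 2 * (r * (c * f)) ≤ r ^ 2 / (K * h) + K * h * (c * f) ^ 2 := by
        have := two_mul_le_add_sq (r / (K * h)) (c * f)
        have h2 := mul_le_mul_of_nonneg_left this (by positivity : 0 ≤ K * h)
        field_simp at h2 ⊢
        linarith
      refine h1.trans (add_le_add ?_ ?_)
      · rw [div_le_iff₀ (by positivity)]
        field_simp
        linarith
      · calc K * h * (c * f) ^ 2 = K * (c ^ 2 * h) * f ^ 2 := by ring
          _ ≤ K * (c ^ 2 * h) * 1 := by gcongr
          _ = K * (c ^ 2 * h) := mul_one _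
    have hlast : (c * f) ^ 2 ≤ c ^ 2 := by
      rw [mul_pow]
      exact mul_le_of_le_one_right (sq_nonneg c) hFt
    have hexp : (K + h⁻¹) * (I + c ^ 2 * h) = K * I + (h⁻¹ * I + K * (c ^ 2 * h)) + c ^ 2 := by
      field_simp
      ring
    rw [hexp]
    linarith [add_sq r (c * f)]

theorem integral_Icc_sq_mul_jacobiWeight {α β : ℝ} (hα : 0 < α + 1) (hβ : 0 < β + 1) (P : ℝ[X]) :
    ∫ y in Set.Icc (-1 : ℝ) 1, P.eval y ^ 2 * ((1 - y) ^ α * (1 + y) ^ β) =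
      2 ^ (α + β + 1) *
        jacobiFunctional hα hβ (P.comp (1 - C 2 * X) * P.comp (1 - C 2 * X)) := by
  have hsub := intervalIntegral.mul_integral_comp_sub_mul (a := 0) (b := 1)
    (f := fun y : ℝ => P.eval y ^ 2 * ((1 - y) ^ α * (1 + y) ^ β)) 2 1
  norm_num at hsub
  rw [integral_Icc_eq_integral_Ioc, ← intervalIntegral.integral_of_le (by norm_num), ← hsub,
    jacobiFunctional_apply, Real.rpow_add_one two_ne_zero, mul_comm ((2 : ℝ) ^ (α + β)), mul_assoc,
    ← intervalIntegral.integral_const_mul (2 ^ (α + β))]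
  congr 1
  refine intervalIntegral.integral_congr fun t ht => ?_
  rw [Set.uIcc_of_le zero_le_one] at ht
  have h1 : (1 + (1 - 2 * t)) = 2 * (1 - t) := by ring
  simp only [eval_mul, eval_comp, eval_sub, eval_one, eval_C, eval_X, add_sub_cancel_right]
  rw [h1, Real.mul_rpow zero_le_two ht.1, Real.mul_rpow zero_le_two (by linarith [ht.2]),
    Real.rpow_add two_pos]
  ring

theorem abs_eval_le_of_natDegree_le_of_le {α β : ℝ} (hβ : -1 < β) (hβα : β ≤ α)
    (hα : -(1 / 2) ≤ α) {n : ℕ} {P : ℝ[X]} (hP : P.natDegree ≤ n) {x : ℝ}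
    (hx : x ∈ Set.Icc (-1 : ℝ) 1) :
    |P.eval x| ≤
      Real.sqrt
        (Real.Gamma (n + α + β + 2) /
            ((2 : ℝ) ^ (α + β + 1) * Real.Gamma (α + 1) * Real.Gamma (n + β + 1)) *
          (Real.Gamma (n + α + 2) / (Real.Gamma (n + 1) * Real.Gamma (α + 2)))) *
        Real.sqrt
          (∫ y in Set.Icc (-1 : ℝ) 1, (P.eval y) ^ 2 * ((1 - y) ^ α * (1 + y) ^ β)) := by
  have hv : 0 < β + 1 := by linarith
  have hu : 0 < α + 1 := by linarith
  have hconst : Real.Gamma (n + α + β + 2) /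
      ((2 : ℝ) ^ (α + β + 1) * Real.Gamma (α + 1) * Real.Gamma (n + β + 1)) *
      (Real.Gamma (n + α + 2) / (Real.Gamma (n + 1) * Real.Gamma (α + 2))) =
      jacobiKernelConst (α + 1) (β + 1) n / 2 ^ (α + β + 1) := by
    rw [jacobiKernelConst, show (n : ℝ) + (α + 1) + (β + 1) = n + α + β + 2 by ring,
      show (n : ℝ) + (α + 1) + 1 = n + α + 2 by ring,
      show (n : ℝ) + (β + 1) = n + β + 1 by ring, show α + 1 + 1 = α + 2 by ring]
    ring
  have hpow : (0 : ℝ) < 2 ^ (α + β + 1) := Real.rpow_pos_of_pos two_pos _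
  have hK := jacobiKernelConst_pos hu hv n
  have hdeg : (P.comp (1 - C 2 * X)).natDegree ≤ n := by
    have hlin : (1 - C 2 * X : ℝ[X]).natDegree ≤ 1 := by compute_degree
    rw [natDegree_comp]
    exact (Nat.mul_le_mul hP hlin).trans_eq (mul_one n)
  have ht : (1 - x) / 2 ∈ Set.Icc (0 : ℝ) 1 := ⟨by linarith [hx.2], by linarith [hx.1]⟩
  have hmain := eval_sq_le_jacobiKernelConst_mul hu hv (by linarith) (by linarith) ht hdeg
  have hxt : 1 - 2 * ((1 - x) / 2) = x := by ring
  simp only [eval_comp, eval_sub, eval_one, eval_mul, eval_C, eval_X, hxt] at hmain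
  rw [hconst, ← Real.sqrt_mul (by positivity), integral_Icc_sq_mul_jacobiWeight hu hv]
  refine Real.abs_le_sqrt (hmain.trans_eq ?_)
  field_simp

/-- Lupaş' inequality: for `q = max(α,β) ≥ -1/2`, `q' = min(α,β) > -1`, every `n ∈ ℕ` and every
polynomial `P` of degree at most `n`,
`sup_{x ∈ [-1,1]} |P(x)| ≤ √(Γ(n+α+β+2) / (2^{α+β+1} Γ(q+1) Γ(n+q'+1)) · C(n+q+1,n)) ·
(∫_{-1}^1 |P(x)|² (1-x)^α (1+x)^β dx)^{1/2}`,
where `C(n+q+1,n) = Γ(n+q+2)/(Γ(n+1)Γ(q+2))`. -/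
theorem lupas_inequality (α β : ℝ) (hq : -(1 / 2) ≤ max α β) (hq' : -1 < min α β)
    (n : ℕ) (P : Polynomial ℝ) (hP : P.natDegree ≤ n) (x : ℝ) (hx : x ∈ Set.Icc (-1 : ℝ) 1) :
    |P.eval x| ≤
      Real.sqrt
        (Real.Gamma (n + α + β + 2) /
            ((2 : ℝ) ^ (α + β + 1) * Real.Gamma (max α β + 1) *
              Real.Gamma (n + min α β + 1)) *
          (Real.Gamma (n + max α β + 2) /
            (Real.Gamma (n + 1) * Real.Gamma (max α β + 2)))) *
        Real.sqrt
          (∫ y in Set.Icc (-1 : ℝ) 1, (P.eval y) ^ 2 * ((1 - y) ^ α * (1 + y) ^ β)) := by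
  rcases le_total β α with h | h
  · rw [max_eq_left h] at hq ⊢
    rw [min_eq_right h] at hq' ⊢
    exact abs_eval_le_of_natDegree_le_of_le hq' h hq hP hx
  · rw [max_eq_right h] at hq ⊢
    rw [min_eq_left h] at hq' ⊢
    have hdeg : (P.comp (-X)).natDegree ≤ n := by
      rwa [natDegree_comp, natDegree_neg, natDegree_X, mul_one]
    have hneg := abs_eval_le_of_natDegree_le_of_le hq' h hq hdeg
      (x := -x) ⟨by linarith [hx.2], by linarith [hx.1]⟩
    have hint : ∫ y in Set.Icc (-1 : ℝ) 1,
        ((P.comp (-X)).eval y) ^ 2 * ((1 - y) ^ β * (1 + y) ^ α) =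
        ∫ y in Set.Icc (-1 : ℝ) 1, (P.eval y) ^ 2 * ((1 - y) ^ α * (1 + y) ^ β) := by
      rw [integral_Icc_eq_integral_Ioc, integral_Icc_eq_integral_Ioc,
        ← intervalIntegral.integral_of_le (by norm_num),
        ← intervalIntegral.integral_of_le (by norm_num), ← neg_neg (1 : ℝ),
        ← intervalIntegral.integral_comp_neg]
      simp [eval_comp, mul_comm, sub_eq_add_neg]
    rw [hint] at hneg
    simpa [eval_comp, add_comm α β, add_right_comm _ α β] using hneg
end

section
/- Let a < b be real numbers, let a ≤ c₁ < ⋯ < c_r ≤ b, and let γ₁, …, γ_r > −1. Set c₀ := a, c_{r+1} := b, γ₀ := 0, γ_{r+1} := 0, and assume max{γ_j, γ_{j+1}} ≥ −1/2 for every 0 ≤ j ≤ r. Define b* := max_{0 ≤ j ≤ r} ( γ_j + γ_{j+1} + |γ_j − γ_{j+1}| + 2 ). Then there exists a constant k > 0, depending only on a, b, c₁, …, c_r, γ₁, …, γ_r, such that for every n ∈ ℕ with n ≥ 1 and every polynomial P ∈ P_n, ∫_a^b |P(x)|² dx ≤ k · n^{b*} · ∫_a^b |P(x)|² ∏_{j=1}^r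 |x−c_j|^{γ_j} dx. -/
open MeasureTheory Polynomial

/-- Endpoint form of Markov's inequality. -/
lemma abs_derivative_eval_endpoint_le {P : ℝ[X]} {n : ℕ} (hP : P.natDegree ≤ n) {M u v : ℝ}
    (hM : 0 < M) (huv : u ≠ v) (hb : ∀ x ∈ Set.uIcc u v, |P.eval x| ≤ M) :
    |(derivative P).eval v| ≤ 2 * n ^ 2 * M / |v - u| := by
  have key : ∀ s : ℝ, |s| = 1 → s * ((v - u) / 2) * (derivative P).eval v ≤ M * n ^ 2 := by
    intro s hs
    set L : ℝ[X] := C ((v - u) / 2) * X + C ((u + v) / 2) with hL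
    have hLe : ∀ x, L.eval x = (v - u) / 2 * x + (u + v) / 2 := by intro x; simp [hL]
    set Q : ℝ[X] := C (s * M⁻¹) * P.comp L with hQ
    have hQd : Q.degree ≤ n := by
      rw [← natDegree_le_iff_degree_le]
      refine (natDegree_C_mul_le _ _).trans (natDegree_comp_le.trans ?_)
      have : L.natDegree ≤ 1 := natDegree_linear_le
      nlinarith
    have hQb : ∀ x ∈ Set.Icc (-1 : ℝ) 1, |Q.eval x| ≤ 1 := by
      rintro x ⟨h1, h2⟩
      have hx : L.eval x ∈ Set.uIcc u v := by
        rw [hLe, Set.mem_uIcc]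
        rcases le_total u v with h | h
        · left; constructor <;> nlinarith
        · right; constructor <;> nlinarith
      have := hb _ hx
      simp only [hQ, eval_mul, eval_C, eval_comp, abs_mul, hs, abs_inv, abs_of_pos hM, one_mul]
      rwa [inv_mul_le_iff₀ hM, mul_one]
    have h := Chebyshev.eval_iterate_derivative_le_of_forall_abs_le_one (k := 1) le_rfl hQd hQb
    simp only [Function.iterate_one] at h
    rw [Chebyshev.derivative_T_eval_one] at h
    have e : (derivative Q).eval 1 = s * M⁻¹ * ((v - u) / 2 * (derivative P).eval v) := by
      have h1 : L.eval 1 = v := by rw [hLe]; ring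
      have h2 : derivative L = C ((v - u) / 2) := by simp [hL]
      rw [hQ, derivative_C_mul, derivative_comp, h2]
      simp [h1]
    rw [e] at h
    push_cast at h
    calc _ = M * (s * M⁻¹ * ((v - u) / 2 * (derivative P).eval v)) := by field_simp
      _ ≤ _ := by gcongr
  have h1 := key 1 (by simp)
  have h2 := key (-1) (by simp)
  have h3 : |(v - u) / 2 * (derivative P).eval v| ≤ M * n ^ 2 := by
    rw [abs_le]; constructor <;> linarith
  rw [abs_mul, abs_div, abs_two] at h3
  rw [le_div_iff₀ (abs_pos.2 (sub_ne_zero.2 huv.symm))]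
  linarith

/-- Markov's inequality on `[a, b]`, with a non-sharp constant. -/
lemma abs_derivative_eval_le {P : ℝ[X]} {n : ℕ} (hP : P.natDegree ≤ n) {M a b : ℝ}
    (hM : 0 < M) (hab : a < b) (hb : ∀ x ∈ Set.Icc a b, |P.eval x| ≤ M) :
    ∀ x ∈ Set.Icc a b, |(derivative P).eval x| ≤ 4 * n ^ 2 * M / (b - a) := by
  rintro x ⟨hxa, hxb⟩
  have key : ∀ u ∈ Set.Icc a b, (b - a) / 2 ≤ |x - u| →
      |(derivative P).eval x| ≤ 4 * n ^ 2 * M / (b - a) := by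
    intro u hu h
    have hne : u ≠ x := by rintro rfl; simp at h; linarith
    refine (abs_derivative_eval_endpoint_le hP hM hne
      fun y hy => hb y (Set.uIcc_subset_Icc hu ⟨hxa, hxb⟩ hy)).trans ?_
    calc _ ≤ 2 * n ^ 2 * M / ((b - a) / 2) := by
          have : 0 < (b - a) / 2 := by linarith
          gcongr
      _ = _ := by field_simp; ring
  rcases le_total x ((a + b) / 2) with h | h
  · refine key b ⟨hab.le, le_rfl⟩ ?_
    rw [abs_of_nonpos] <;> linarith
  · refine key a ⟨le_rfl, hab.le⟩ ?_
    rw [abs_of_nonneg] <;> linarith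

/-- Nikolskii's inequality between the sup norm and the `L²` norm on `[a, b]`. -/
lemma sq_eval_le_integral_sq {P : ℝ[X]} {n : ℕ} (hn : 1 ≤ n) (hP : P.natDegree ≤ n) {a b : ℝ}
    (hab : a < b) :
    ∀ x ∈ Set.Icc a b, P.eval x ^ 2 ≤
      32 * n ^ 2 / (b - a) * ∫ y in Set.Icc a b, P.eval y ^ 2 := by
  obtain ⟨x₀, hx₀, hmax⟩ := isCompact_Icc.exists_isMaxOn (Set.nonempty_Icc.2 hab.le)
    (f := fun x => |P.eval x|) (by fun_prop)
  have hmax' : ∀ x ∈ Set.Icc a b, |P.eval x| ≤ |P.eval x₀| := fun x hx => hmax hx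
  set M := |P.eval x₀| with hMdef
  have hn1 : (1 : ℝ) ≤ n := by exact_mod_cast hn
  have hn2 : (1 : ℝ) ≤ n ^ 2 := one_le_pow₀ hn1
  have hba : 0 < b - a := by linarith
  suffices h : M ^ 2 ≤ 32 * n ^ 2 / (b - a) * ∫ y in Set.Icc a b, P.eval y ^ 2 by
    intro x hx
    refine le_trans ?_ h
    rw [← sq_abs]
    have := hmax' x hx
    gcongr
  rcases (abs_nonneg (P.eval x₀)).eq_or_lt with h0 | hM
  · rw [← hMdef] at h0
    rw [← h0]
    have : 0 ≤ ∫ y in Set.Icc a b, P.eval y ^ 2 := integral_nonneg fun _ => sq_nonneg _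
    simp only [ne_eq, OfNat.ofNat_ne_zero, not_false_eq_true, zero_pow]
    positivity
  rw [← hMdef] at hM
  have hlip : ∀ x ∈ Set.Icc a b, |P.eval x - P.eval x₀| ≤ 4 * n ^ 2 * M / (b - a) * |x - x₀| := by
    intro x hx
    refine (convex_Icc a b).norm_image_sub_le_of_norm_deriv_le (f := fun x => P.eval x)
      (fun y _ => P.differentiableAt) (fun y hy => ?_) hx₀ hx
    rw [Polynomial.deriv]
    exact abs_derivative_eval_le hP hM hab hmax' y hy
  set h : ℝ := (b - a) / (8 * n ^ 2) with hh
  have hpos : 0 < h := by positivity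
  have hle : h ≤ (b - a) / 2 := by
    rw [hh]; gcongr; linarith
  have hlow : ∀ x ∈ Set.Icc a b, |x - x₀| ≤ h → M ^ 2 / 4 ≤ P.eval x ^ 2 := by
    intro x hx hxh
    have h1 : |P.eval x - P.eval x₀| ≤ M / 2 := by
      refine (hlip x hx).trans ?_
      calc _ ≤ 4 * n ^ 2 * M / (b - a) * h := by gcongr
        _ = M / 2 := by rw [hh]; field_simp; norm_num
    have h2 : M / 2 ≤ |P.eval x| := by
      have := abs_sub_abs_le_abs_sub (P.eval x₀) (P.eval x)
      rw [abs_sub_comm] at this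
      linarith
    rw [← sq_abs (P.eval x)]
    calc M ^ 2 / 4 = (M / 2) ^ 2 := by ring
      _ ≤ _ := by gcongr
  obtain ⟨p, hpa, hpb, hpx⟩ : ∃ p, a ≤ p ∧ p + h ≤ b ∧
      ∀ x ∈ Set.Icc p (p + h), |x - x₀| ≤ h := by
    rcases le_total x₀ ((a + b) / 2) with hm | hm
    · refine ⟨x₀, hx₀.1, by linarith, fun x hx => ?_⟩
      rw [abs_le]; constructor <;> linarith [hx.1, hx.2]
    · refine ⟨x₀ - h, by linarith, by linarith [hx₀.2], fun x hx => ?_⟩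
      rw [abs_le]; constructor <;> linarith [hx.1, hx.2]
  have hsub : Set.Icc p (p + h) ⊆ Set.Icc a b := Set.Icc_subset_Icc hpa hpb
  have hint : ∀ u v : ℝ, IntegrableOn (fun y => P.eval y ^ 2) (Set.Icc u v) := fun u v =>
    (by fun_prop : Continuous fun y => P.eval y ^ 2).integrableOn_Icc
  have h3 : M ^ 2 / 4 * h ≤ ∫ y in Set.Icc a b, P.eval y ^ 2 := by
    calc M ^ 2 / 4 * h = M ^ 2 / 4 * volume.real (Set.Icc p (p + h)) := by
          rw [Real.volume_real_Icc_of_le (by linarith)]; ring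
      _ ≤ ∫ y in Set.Icc p (p + h), P.eval y ^ 2 :=
          setIntegral_ge_of_const_le_real measurableSet_Icc (by simp)
            (fun x hx => hlow x (hsub hx) (hpx x hx)) (hint _ _)
      _ ≤ _ := setIntegral_mono_set (hint _ _)
            (Filter.Eventually.of_forall fun _ => sq_nonneg _) hsub.eventuallyLE
  calc M ^ 2 = 32 * n ^ 2 / (b - a) * (M ^ 2 / 4 * h) := by rw [hh]; field_simp; norm_num
    _ ≤ _ := by gcongr

/-- On a bounded interval, a product of power singularities at distinct points is comparable to the
single factor attached to the nearest singular point. -/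
lemma exists_prod_abs_sub_rpow_comparable {a b : ℝ} {s : Finset ℕ} (hs : s.Nonempty) {c γ : ℕ → ℝ}
    (hc : Set.InjOn c s) (hcs : ∀ j ∈ s, c j ∈ Set.Icc a b) :
    ∃ m K : ℝ, 0 < m ∧ 0 < K ∧ ∀ x ∈ Set.Icc a b, ∃ i ∈ s,
      m * |x - c i| ^ γ i ≤ ∏ j ∈ s, |x - c j| ^ γ j ∧
      ∏ j ∈ s, |x - c j| ^ γ j ≤ K * |x - c i| ^ γ i := by
  obtain ⟨σ, hσ, hσ0⟩ : ∃ σ : ℝ, (∀ p ∈ s.offDiag, σ ≤ |c p.1 - c p.2| / 2) ∧ 0 < σ := by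
    refine (((Filter.eventually_all_finset _).2 fun p hp => ?_).and
      (self_mem_nhdsWithin : Set.Ioi (0 : ℝ) ∈ nhdsWithin 0 (Set.Ioi 0))).exists
    rw [Finset.mem_offDiag] at hp
    have : 0 < |c p.1 - c p.2| / 2 :=
      half_pos (abs_pos.2 (sub_ne_zero.2 fun h => hp.2.2 (hc hp.1 hp.2.1 h)))
    exact nhdsWithin_le_nhds (Iic_mem_nhds this)
  set R := max (b - a) σ
  have hR0 : 0 < R := hσ0.trans_le (le_max_right _ _)
  obtain ⟨L, hL, hL0⟩ : ∃ L : ℝ, (∀ j ∈ s, L ≤ min (σ ^ γ j) (R ^ γ j)) ∧ 0 < L := by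
    refine (((Filter.eventually_all_finset _).2 fun j _ => ?_).and
      (self_mem_nhdsWithin : Set.Ioi (0 : ℝ) ∈ nhdsWithin 0 (Set.Ioi 0))).exists
    exact nhdsWithin_le_nhds (Iic_mem_nhds (lt_min (by positivity) (by positivity)))
  obtain ⟨U, hU, hU0⟩ : ∃ U : ℝ, (∀ j ∈ s, max (σ ^ γ j) (R ^ γ j) ≤ U) ∧ 0 < U :=
    (((Filter.eventually_all_finset _).2 fun j _ => Filter.eventually_ge_atTop _).and
      (Filter.eventually_gt_atTop 0)).exists
  have hLU : ∀ j ∈ s, ∀ t, σ ≤ t → t ≤ R → L ≤ t ^ γ j ∧ t ^ γ j ≤ U := by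
    intro j hj t h1 h2
    have ht := hσ0.trans_le h1
    have hL' := le_min_iff.1 (hL j hj)
    have hU' := max_le_iff.1 (hU j hj)
    rcases le_total 0 (γ j) with h | h
    · exact ⟨hL'.1.trans (Real.rpow_le_rpow hσ0.le h1 h),
        (Real.rpow_le_rpow ht.le h2 h).trans hU'.2⟩
    · exact ⟨hL'.2.trans (Real.rpow_le_rpow_of_nonpos ht h2 h),
        (Real.rpow_le_rpow_of_nonpos hσ0 h1 h).trans hU'.1⟩
  refine ⟨L ^ (s.card - 1), U ^ (s.card - 1), by positivity, by positivity, fun x hx => ?_⟩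
  obtain ⟨i, hi, hmin⟩ := s.exists_min_image (fun j => |x - c j|) hs
  have hother : ∀ j ∈ s.erase i, L ≤ |x - c j| ^ γ j ∧ |x - c j| ^ γ j ≤ U := by
    intro j hj
    obtain ⟨hji, hj⟩ := Finset.mem_erase.1 hj
    refine hLU j hj _ ?_ ?_
    · have h1 := hσ (i, j) (Finset.mem_offDiag.2 ⟨hi, hj, hji.symm⟩)
      have h2 := hmin j hj
      have h3 := abs_sub_le (c i) x (c j)
      rw [abs_sub_comm (c i) x] at h3
      simp only at h1 h2
      linarith
    · refine le_trans ?_ (le_max_left _ _)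
      have := hcs j hj
      rw [abs_le]; constructor <;> linarith [hx.1, hx.2, this.1, this.2]
  refine ⟨i, hi, ?_⟩
  rw [← Finset.prod_erase_mul s _ hi, ← Finset.card_erase_of_mem hi, ← Finset.prod_const,
    ← Finset.prod_const]
  constructor
  · gcongr with j hj
    exact (hother j hj).1
  · gcongr with j hj
    exact (hother j hj).2

lemma integrableOn_Icc_abs_sub_rpow {γ : ℝ} (hγ : -1 < γ) (a b c : ℝ) :
    IntegrableOn (fun x : ℝ => |x - c| ^ γ) (Set.Icc a b) := by
  have hpos : ∀ t : ℝ, 0 ≤ t → IntervalIntegrable (fun x : ℝ => |x| ^ γ) volume 0 t := by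
    intro t ht
    refine (intervalIntegral.intervalIntegrable_rpow' hγ).congr fun x hx => ?_
    rw [Set.uIoc_of_le ht] at hx
    simp only [abs_of_pos hx.1]
  have h0 : ∀ t : ℝ, IntervalIntegrable (fun x : ℝ => |x| ^ γ) volume 0 t := by
    intro t
    rcases le_total 0 t with ht | ht
    · exact hpos t ht
    · simpa using (IntervalIntegrable.iff_comp_neg (by simp)).1 (hpos (-t) (by linarith))
  have h : IntervalIntegrable (fun x : ℝ => |x - c| ^ γ) volume a b := by
    have := ((h0 (a - c)).symm.trans (h0 (b - c))).comp_sub_right c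
    simpa using this
  rcases le_total a b with hab | hab
  · rwa [intervalIntegrable_iff_integrableOn_Icc_of_le hab] at h
  · exact IntegrableOn.of_measure_zero ((Set.subsingleton_Icc_of_ge hab).measure_zero volume)

lemma integrableOn_Icc_prod_abs_sub_rpow {a b : ℝ} {s : Finset ℕ} (hs : s.Nonempty) {c γ : ℕ → ℝ}
    (hc : Set.InjOn c s) (hcs : ∀ j ∈ s, c j ∈ Set.Icc a b) (hγ : ∀ j ∈ s, -1 < γ j) :
    IntegrableOn (fun x : ℝ => ∏ j ∈ s, |x - c j| ^ γ j) (Set.Icc a b) := by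
  obtain ⟨_, K, _, hK, h⟩ := exists_prod_abs_sub_rpow_comparable (γ := γ) hs hc hcs
  have hg : IntegrableOn (fun x : ℝ => K * ∑ i ∈ s, |x - c i| ^ γ i) (Set.Icc a b) :=
    (integrable_finsetSum s fun i hi =>
      integrableOn_Icc_abs_sub_rpow (hγ i hi) a b (c i)).const_mul K
  refine Integrable.mono' hg (Measurable.aestronglyMeasurable (by fun_prop)) ?_
  refine (ae_restrict_iff' measurableSet_Icc).2 (Filter.Eventually.of_forall fun x hx => ?_)
  obtain ⟨i, hi, -, hle⟩ := h x hx
  rw [Real.norm_of_nonneg (by positivity)]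
  refine hle.trans ?_
  gcongr
  exact Finset.single_le_sum (f := fun i => |x - c i| ^ γ i) (fun _ _ => by positivity) hi

/-- Away from `δ`-neighbourhoods of its singular points, a product of powers with exponents at most
`G` is bounded below by a multiple of `δ ^ G`. -/
lemma exists_mul_rpow_le_prod_abs_sub_rpow {a b : ℝ} {s : Finset ℕ} (hs : s.Nonempty)
    {c γ : ℕ → ℝ} (hc : Set.InjOn c s) (hcs : ∀ j ∈ s, c j ∈ Set.Icc a b) {G : ℝ} (hG : 0 ≤ G)
    (hγ : ∀ j ∈ s, γ j ≤ G) :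
    ∃ m : ℝ, 0 < m ∧ ∀ δ, 0 < δ → δ ≤ 1 → ∀ x ∈ Set.Icc a b, (∀ j ∈ s, δ ≤ |x - c j|) →
      m * δ ^ G ≤ ∏ j ∈ s, |x - c j| ^ γ j := by
  obtain ⟨m, _, hm, _, h⟩ := exists_prod_abs_sub_rpow_comparable (γ := γ) hs hc hcs
  set R := max (b - a) 1
  have hR0 : 0 < R := zero_lt_one.trans_le (le_max_right _ _)
  obtain ⟨L, hL, hL0⟩ : ∃ L : ℝ, (∀ j ∈ s, L ≤ min 1 (R ^ γ j)) ∧ 0 < L := by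
    refine (((Filter.eventually_all_finset _).2 fun j _ => ?_).and
      (self_mem_nhdsWithin : Set.Ioi (0 : ℝ) ∈ nhdsWithin 0 (Set.Ioi 0))).exists
    exact nhdsWithin_le_nhds (Iic_mem_nhds (lt_min one_pos (by positivity)))
  refine ⟨m * L, by positivity, fun δ hδ hδ1 x hx hfar => ?_⟩
  obtain ⟨i, hi, hle, -⟩ := h x hx
  refine le_trans ?_ hle
  rw [mul_assoc]
  gcongr
  have hL' := le_min_iff.1 (hL i hi)
  have hxR : |x - c i| ≤ R := by
    refine le_trans ?_ (le_max_left _ _)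
    have := hcs i hi
    rw [abs_le]; constructor <;> linarith [hx.1, hx.2, this.1, this.2]
  rcases le_total 0 (γ i) with h0 | h0
  · calc L * δ ^ G ≤ 1 * δ ^ γ i := by
          gcongr ?_ * ?_
          · exact hL'.1
          · exact Real.rpow_le_rpow_of_exponent_ge hδ hδ1 (hγ i hi)
      _ ≤ _ := by
          rw [one_mul]
          exact Real.rpow_le_rpow hδ.le (hfar i hi) h0
  · calc L * δ ^ G ≤ R ^ γ i * 1 := by
          gcongr ?_ * ?_
          · exact hL'.2
          · exact Real.rpow_le_one hδ.le hδ1 hG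
      _ ≤ _ := by
          rw [mul_one]
          exact Real.rpow_le_rpow_of_nonpos (hδ.trans_le (hfar i hi)) hxR h0

/-- Small neighbourhoods of finitely many points carry at most half of the `L²` mass of a
polynomial. -/
lemma integral_sq_le_two_mul_integral_sq_far {P : ℝ[X]} {n : ℕ} (hn : 1 ≤ n) (hP : P.natDegree ≤ n)
    {a b : ℝ} (hab : a < b) {s : Finset ℕ} (c : ℕ → ℝ) {δ : ℝ} (hδ0 : 0 ≤ δ)
    (hδ : 128 * s.card * n ^ 2 * δ ≤ b - a) :
    ∫ x in Set.Icc a b, P.eval x ^ 2 ≤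
      2 * ∫ x in Set.Icc a b ∩ {x | ∀ j ∈ s, δ ≤ |x - c j|}, P.eval x ^ 2 := by
  set F : Set ℝ := {x | ∀ j ∈ s, δ ≤ |x - c j|} with hF
  have hFm : MeasurableSet F := by
    have : F = ⋂ j ∈ s, {x | δ ≤ |x - c j|} := by ext; simp [hF]
    rw [this]
    exact Finset.measurableSet_biInter s fun j _ => measurableSet_le (by fun_prop) (by fun_prop)
  set I := ∫ x in Set.Icc a b, P.eval x ^ 2 with hI
  have hint : IntegrableOn (fun y => P.eval y ^ 2) (Set.Icc a b) :=
    (by fun_prop : Continuous fun y => P.eval y ^ 2).integrableOn_Icc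
  have hI0 : 0 ≤ I := integral_nonneg fun _ => sq_nonneg _
  have hba : 0 < b - a := by linarith
  have hsplit := integral_inter_add_sdiff hFm hint
  have hvol : volume.real (Set.Icc a b \ F) ≤ s.card * (2 * δ) := by
    have hsub : Set.Icc a b \ F ⊆ ⋃ j ∈ s, Set.Icc (c j - δ) (c j + δ) := by
      rintro x ⟨-, hx⟩
      simp only [hF, Set.mem_ofPred_eq, not_forall, not_le] at hx
      obtain ⟨j, hj, hx⟩ := hx
      rw [abs_lt] at hx
      simp only [Set.mem_iUnion]
      exact ⟨j, hj, by linarith [hx.1], by linarith [hx.2]⟩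
    calc volume.real (Set.Icc a b \ F) ≤ volume.real (⋃ j ∈ s, Set.Icc (c j - δ) (c j + δ)) :=
          measureReal_mono hsub
            ((measure_biUnion_lt_top s.finite_toSet fun j _ => measure_Icc_lt_top).ne)
      _ ≤ ∑ j ∈ s, volume.real (Set.Icc (c j - δ) (c j + δ)) :=
          measureReal_biUnion_finset_le s _
      _ = ∑ j ∈ s, 2 * δ := by
          refine Finset.sum_congr rfl fun j _ => ?_
          rw [Real.volume_real_Icc_of_le (by linarith)]; ring
      _ = _ := by simp
  have hnear : ∫ x in Set.Icc a b \ F, P.eval x ^ 2 ≤ I / 2 := by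
    have h1 := norm_setIntegral_le_of_norm_le_const (f := fun x => P.eval x ^ 2)
      (s := Set.Icc a b \ F) (μ := volume) (C := 32 * n ^ 2 / (b - a) * I)
      ((measure_mono Set.sdiff_subset).trans_lt measure_Icc_lt_top) (fun x hx => by
        rw [Real.norm_of_nonneg (sq_nonneg _)]
        exact sq_eval_le_integral_sq hn hP hab x hx.1)
    calc _ ≤ _ := (le_abs_self _).trans h1
      _ ≤ 32 * n ^ 2 / (b - a) * I * (s.card * (2 * δ)) := by gcongr
      _ = (128 * s.card * n ^ 2 * δ) * (I / (2 * (b - a))) := by field_simp; ring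
      _ ≤ (b - a) * (I / (2 * (b - a))) := by gcongr
      _ = I / 2 := by field_simp
  linarith

/-- Comparison between the unweighted L²-norm and the L²-norm with the weight
`∏_{j=1}^r |x-c_j|^{γ_j}` on `[a,b]`: with `a ≤ c₁ < ⋯ < c_r ≤ b`, `γ_j > -1`,
`c₀ = a`, `c_{r+1} = b`, `γ₀ = γ_{r+1} = 0`, `max{γ_j, γ_{j+1}} ≥ -1/2` for `0 ≤ j ≤ r`,
and `b* = max_{0 ≤ j ≤ r} (γ_j + γ_{j+1} + |γ_j - γ_{j+1}| + 2)`. -/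
theorem unweighted_le_generalized_jacobi_weighted (a b : ℝ) (hab : a < b)
    (r : ℕ) (hr : 1 ≤ r) (c γ : ℕ → ℝ)
    (hc0 : c 0 = a) (hcr1 : c (r + 1) = b)
    (ha1 : a ≤ c 1) (hrb : c r ≤ b)
    (hc : ∀ i j, 1 ≤ i → i < j → j ≤ r → c i < c j)
    (hγ : ∀ j ∈ Finset.Icc 1 r, -1 < γ j)
    (hγ0 : γ 0 = 0) (hγr1 : γ (r + 1) = 0)
    (hhalf : ∀ j ≤ r, -(1 / 2) ≤ max (γ j) (γ (j + 1)))
    (bstar : ℝ)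
    (hbstar : IsGreatest
      {x : ℝ | ∃ j ≤ r, x = γ j + γ (j + 1) + |γ j - γ (j + 1)| + 2} bstar) :
    ∃ k : ℝ, 0 < k ∧ ∀ (n : ℕ), 1 ≤ n → ∀ P : Polynomial ℝ, P.natDegree ≤ n →
      ∫ x in Set.Icc a b, (P.eval x) ^ 2 ≤
        k * (n : ℝ) ^ bstar *
          ∫ x in Set.Icc a b, (P.eval x) ^ 2 * ∏ j ∈ Finset.Icc 1 r, |x - c j| ^ γ j := by
  have hs : (Finset.Icc 1 r).Nonempty := Finset.nonempty_Icc.2 hr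
  have hinj : Set.InjOn c (Finset.Icc 1 r : Finset ℕ) := by
    intro i hi j hj hij
    simp only [Finset.coe_Icc, Set.mem_Icc] at hi hj
    rcases lt_trichotomy i j with h | h | h
    · exact absurd hij (hc i j hi.1 h hj.2).ne
    · exact h
    · exact absurd hij (hc j i hj.1 h hi.2).ne'
  have hcs : ∀ j ∈ Finset.Icc 1 r, c j ∈ Set.Icc a b := by
    intro j hj
    rw [Finset.mem_Icc] at hj
    constructor
    · rcases hj.1.eq_or_lt with h | h
      · rwa [← h]
      · exact ha1.trans (hc 1 j le_rfl h hj.2).le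
    · rcases hj.2.eq_or_lt with h | h
      · rwa [h]
      · exact (hc j r hj.1 h le_rfl).le.trans hrb
  set G : ℝ := (bstar - 2) / 2 with hGdef
  have hmax : ∀ j ≤ r, γ j ≤ G ∧ γ (j + 1) ≤ G := by
    intro j hj
    have := hbstar.2 ⟨j, hj, rfl⟩
    have h1 := le_abs_self (γ j - γ (j + 1))
    have h2 := neg_abs_le (γ j - γ (j + 1))
    constructor <;> linarith
  have hG : 0 ≤ G := hγ0 ▸ (hmax 0 (Nat.zero_le r)).1
  obtain ⟨m, hm, hlow⟩ := exists_mul_rpow_le_prod_abs_sub_rpow hs hinj hcs hG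
    fun j hj => (hmax j (Finset.mem_Icc.1 hj).2).1
  have hr0 : (0 : ℝ) < r := by exact_mod_cast hr
  have hba : 0 < b - a := by linarith
  set ε : ℝ := min 1 ((b - a) / (128 * r)) with hε
  have hε0 : 0 < ε := lt_min one_pos (by positivity)
  refine ⟨2 * (m * ε ^ G)⁻¹, by positivity, fun n hn P hP => ?_⟩
  have hn1 : (1 : ℝ) ≤ n := by exact_mod_cast hn
  have hn0 : (0 : ℝ) < n := by linarith
  set δ : ℝ := ε / n ^ 2 with hδ
  have hδ0 : 0 < δ := by positivity
  have hδ1 : δ ≤ 1 := div_le_one_of_le₀ ((min_le_left _ _).trans (one_le_pow₀ hn1)) (by positivity)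
  set w : ℝ → ℝ := fun x => ∏ j ∈ Finset.Icc 1 r, |x - c j| ^ γ j with hw
  have hw0 : ∀ x, 0 ≤ w x := fun x => Finset.prod_nonneg fun j _ => by positivity
  have hwint : IntegrableOn (fun x => P.eval x ^ 2 * w x) (Set.Icc a b) :=
    (integrableOn_Icc_prod_abs_sub_rpow hs hinj hcs hγ).continuousOn_mul (by fun_prop)
      isCompact_Icc
  have hhalf_mass := integral_sq_le_two_mul_integral_sq_far hn hP hab (s := Finset.Icc 1 r) c
    hδ0.le (by
      rw [Nat.card_Icc, Nat.add_sub_cancel, hδ]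
      calc 128 * (r : ℝ) * n ^ 2 * (ε / n ^ 2) = 128 * r * ε := by field_simp
        _ ≤ 128 * r * ((b - a) / (128 * r)) := by gcongr; exact min_le_right _ _
        _ = b - a := by field_simp)
  set F : Set ℝ := {x | ∀ j ∈ Finset.Icc 1 r, δ ≤ |x - c j|} with hF
  have hFm : MeasurableSet F := by
    have : F = ⋂ j ∈ Finset.Icc 1 r, {x | δ ≤ |x - c j|} := by ext; simp [hF]
    rw [this]
    exact Finset.measurableSet_biInter _ fun j _ => measurableSet_le (by fun_prop) (by fun_prop)
  have hsub : Set.Icc a b ∩ F ⊆ Set.Icc a b := Set.inter_subset_left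
  have hPint : IntegrableOn (fun y => P.eval y ^ 2) (Set.Icc a b) :=
    (by fun_prop : Continuous fun y => P.eval y ^ 2).integrableOn_Icc
  have hW0 : 0 ≤ ∫ x in Set.Icc a b, P.eval x ^ 2 * w x :=
    integral_nonneg fun x => mul_nonneg (sq_nonneg _) (hw0 x)
  have hfar : m * δ ^ G * ∫ x in Set.Icc a b ∩ F, P.eval x ^ 2 ≤
      ∫ x in Set.Icc a b, P.eval x ^ 2 * w x := by
    rw [← integral_const_mul]
    calc _ ≤ ∫ x in Set.Icc a b ∩ F, P.eval x ^ 2 * w x := by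
          refine setIntegral_mono_on ((hPint.mono_set hsub).const_mul _) (hwint.mono_set hsub)
            (measurableSet_Icc.inter hFm) fun x hx => ?_
          rw [mul_comm]
          gcongr
          exact hlow δ hδ0 hδ1 x hx.1 hx.2
      _ ≤ _ := setIntegral_mono_set hwint
          (Filter.Eventually.of_forall fun x => mul_nonneg (sq_nonneg _) (hw0 x))
          hsub.eventuallyLE
  have hδG : δ ^ G * (n : ℝ) ^ (2 * G) = ε ^ G := by
    rw [hδ, Real.div_rpow hε0.le (by positivity), Real.rpow_mul hn0.le]
    norm_cast
    field_simp
  have hpow : (n : ℝ) ^ (2 * G) ≤ (n : ℝ) ^ bstar :=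
    Real.rpow_le_rpow_of_exponent_le hn1 (by rw [hGdef]; linarith)
  calc _ ≤ _ := hhalf_mass
    _ = 2 * (m * ε ^ G)⁻¹ * (n : ℝ) ^ (2 * G) *
        (m * δ ^ G * ∫ x in Set.Icc a b ∩ F, P.eval x ^ 2) := by
          rw [← hδG]
          have : 0 < (n : ℝ) ^ (2 * G) := by positivity
          have : 0 < δ ^ G := by positivity
          field_simp
    _ ≤ _ := by gcongr
end
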